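/- Global defining functions with good properties: let 1 ≤ k ≤ n and S ⊂ ℍ^n. The following are equivalent: (i) S is a k-codimensional C¹_ℍ-regular submanifold; (ii) for every p ∈ S there exist an open set U with p ∈ U, a function f : ℍ^n → ℝ^k and δ₀ > 0 such that, up to composing with an isometry of ℍ^n, (1) f ∈ C¹_ℍ(ℍ^n, ℝ^k), (2) |∇_ℍ f| is bounded on ℍ^n, (3) f ∈ C^∞(ℍ^n ∖ {f = 0}, ℝ^k), (4) the k×k matrix ∇̂_ℍ f(q) := [X_i f_j(q)]_{1≤i,j≤k} satisfies ∇̂_ℍ f(q) ≥ δ₀ Id_{k×k} for every q ∈ ℍ^n in the sense of quadratic forms, and (5) S ∩ U = {q ∈ U : f(q) = 0}. -/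

import Mathlib

open MeasureTheory Topology Filter Set ENNReal

noncomputable section
namespace Heis

/-- Points of the `n`-th Heisenberg group `ℍⁿ ≡ ℝⁿ × ℝⁿ × ℝ`, `p = (x, y, t)`. -/
abbrev Hpt (n : ℕ) : Type := (Fin n → ℝ) × (Fin n → ℝ) × ℝ

variable {n : ℕ}

/-- The Heisenberg group operation. -/
def hmul (p q : Hpt n) : Hpt n :=
  (p.1 + q.1, p.2.1 + q.2.1,
    p.2.2 + q.2.2 + (∑ j, p.1 j * q.2.1 j) / 2 - (∑ j, q.1 j * p.2.1 j) / 2)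

/-- Group inverse. -/
def hinv (p : Hpt n) : Hpt n := (-p.1, -p.2.1, -p.2.2)

/-- Anisotropic dilations `δ_λ(x,y,t) = (λx, λy, λ²t)`. -/
def hdil (l : ℝ) (p : Hpt n) : Hpt n := (l • p.1, l • p.2.1, l ^ 2 * p.2.2)

/-- The value at `p` of the `j`-th left invariant frame field `X₁,…,Xₙ,Y₁,…,Yₙ,T`,
expressed in the coordinates of `ℝ^{2n+1}`. -/
def frameVec (j : Fin (2*n+1)) (p : Hpt n) : Hpt n :=
  if h : (j : ℕ) < n then
    (Pi.single (⟨j, h⟩ : Fin n) 1, 0, -(p.2.1 ⟨j, h⟩) / 2)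
  else if h' : (j : ℕ) < 2*n then
    (0, Pi.single (⟨(j:ℕ) - n, by omega⟩ : Fin n) 1, p.1 ⟨(j:ℕ) - n, by omega⟩ / 2)
  else (0, 0, 1)

/-- Inclusion of horizontal indices. -/
def hIdx (j : Fin (2*n)) : Fin (2*n+1) := Fin.castLE (by omega) j

/-- Horizontal gradient `∇_ℍ f = (X₁f,…,Xₙf,Y₁f,…,Yₙf)` (pointwise derivatives along the
horizontal left-invariant fields). -/
def gradH (f : Hpt n → ℝ) (p : Hpt n) : Fin (2*n) → ℝ :=
  fun j => lineDeriv ℝ f p (frameVec (hIdx j) p)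

/-- `f` is of class `C¹_ℍ` on `U`: it is continuous and its horizontal derivatives exist and
are (represented by) continuous functions on `U`. -/
structure IsC1H (U : Set (Hpt n)) (f : Hpt n → ℝ) : Prop where
  contOn : ContinuousOn f U
  ldiff : ∀ p ∈ U, ∀ j : Fin (2*n), LineDifferentiableAt ℝ f p (frameVec (hIdx j) p)
  contGrad : ∀ j : Fin (2*n), ContinuousOn (fun p => gradH f p j) U

/-- Horizontal gradient as a frame-coefficient vector in `ℝ^{2n+1}` (with zero `T`-component). -/
def gradF (f : Hpt n → ℝ) (q : Hpt n) : Fin (2*n+1) → ℝ :=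
  fun j => if h : (j:ℕ) < 2*n then gradH f q ⟨j, h⟩ else 0

/-- Horizontal derivative indexed by a natural number (0 outside the horizontal range). -/
def gradNat (f : Hpt n → ℝ) (q : Hpt n) (i : ℕ) : ℝ :=
  if h : i < 2*n then gradH f q ⟨i, h⟩ else 0

/-- The Pansu differential of a `C¹_ℍ` function: `d_ℍf_p(x,y,t) = Σⱼ(xⱼXⱼf(p) + yⱼYⱼf(p))`. -/
def pansuD (f : Hpt n → ℝ) (p : Hpt n) (q : Hpt n) : ℝ :=
  ∑ j : Fin n, (q.1 j * gradH f p ⟨(j:ℕ), by omega⟩ + q.2.1 j * gradH f p ⟨n + (j:ℕ), by omega⟩)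

/-- `S` is a `k`-codimensional `C¹_ℍ`-regular submanifold. -/
def IsC1HCodim (k : ℕ) (S : Set (Hpt n)) : Prop :=
  ∀ p ∈ S, ∃ U : Set (Hpt n), IsOpen U ∧ p ∈ U ∧
    ∃ f : Fin k → Hpt n → ℝ,
      (∀ i, IsC1H U (f i)) ∧
      (∀ q ∈ U, LinearIndependent ℝ (fun i => gradH (f i) q)) ∧
      S ∩ U = {q ∈ U | ∀ i, f i q = 0}

/-- `L : ℝ^k → ℍⁿ` is a group homomorphism. -/
def IsGroupHomH {k : ℕ} (L : (Fin k → ℝ) → Hpt n) : Prop :=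
  ∀ a b, L (a + b) = hmul (L a) (L b)

/-- Pansu differentiability of `f : ℝ^k → ℍⁿ` at `a`:
`δ_{1/λ}(f(a)⁻¹ ⬝ f(a + λb)) → L(b)` locally uniformly in `b`, with `L` a group homomorphism. -/
def HasPansuDerivAt {k : ℕ} (f : (Fin k → ℝ) → Hpt n) (L : (Fin k → ℝ) → Hpt n)
    (a : Fin k → ℝ) : Prop :=
  IsGroupHomH L ∧
    TendstoLocallyUniformly
      (fun (l : ℝ) (b : Fin k → ℝ) => hdil l⁻¹ (hmul (hinv (f a)) (f (a + l • b)))) L (𝓝[>] 0)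

/-- `S` is a `k`-dimensional (`k ≤ n`) `C¹_ℍ`-regular submanifold: locally the injective image
of an open set of `ℝ^k` under a continuously Pansu differentiable map with injective
Pansu differential. -/
def IsC1HDim (k : ℕ) (S : Set (Hpt n)) : Prop :=
  ∀ p ∈ S, ∃ U : Set (Hpt n), IsOpen U ∧ p ∈ U ∧
    ∃ V : Set (Fin k → ℝ), IsOpen V ∧
    ∃ (f : (Fin k → ℝ) → Hpt n) (Df : (Fin k → ℝ) → (Fin k → ℝ) → Hpt n),
      Set.InjOn f V ∧ Set.MapsTo f V U ∧
      (∀ a ∈ V, HasPansuDerivAt f (Df a) a ∧ Function.Injective (Df a)) ∧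
      (∀ b, ContinuousOn (fun a => Df a b) V) ∧
      S ∩ U = f '' V

/-- `C¹_ℍ`-regular submanifold of codimension `k`, for any `1 ≤ k ≤ 2n+1` (for `k ≥ n+1` this
means a low-dimensional submanifold of dimension `2n+1-k`). -/
def IsC1HSub (k : ℕ) (S : Set (Hpt n)) : Prop :=
  if k ≤ n then IsC1HCodim k S else IsC1HDim (2*n+1-k) S

/-! ## Distances and measures -/

/-- Open ball of a distance function. -/
def rawBall (d : Hpt n → Hpt n → ℝ) (p : Hpt n) (r : ℝ) : Set (Hpt n) := {q | d p q < r}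

/-- The gauge used to define the spherical Hausdorff measure of dimension `m` at scale `r`. -/
def sphGauge (d : Hpt n → Hpt n → ℝ) (m r : ℝ) (s : Set (Hpt n)) : ℝ≥0∞ :=
  ⨅ (c : Hpt n) (ρ : ℝ) (_ : 0 < ρ) (_ : ρ < r) (_ : s ⊆ rawBall d c ρ),
    ENNReal.ofReal ((2*ρ) ^ m)

/-- Spherical pre-measure at scale `r`. -/
def sphPre (d : Hpt n → Hpt n → ℝ) (m r : ℝ) : OuterMeasure (Hpt n) :=
  OuterMeasure.boundedBy (sphGauge d m r)

/-- The spherical Hausdorff outer measure `𝒮^m` associated with `d`. -/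
def sphOuter (d : Hpt n → Hpt n → ℝ) (m : ℝ) : OuterMeasure (Hpt n) :=
  ⨆ (r : ℝ) (_ : 0 < r), sphPre d m r

/-- A left invariant, homogeneous, rotationally invariant distance on `ℍⁿ`.
(The field `carat` records the — automatically true — fact that Borel sets are
Carathéodory measurable for the associated spherical measures.) -/
structure HomDist (n : ℕ) where
  d : Hpt n → Hpt n → ℝ
  symm : ∀ p q, d p q = d q p
  triangle : ∀ p q r, d p r ≤ d p q + d q r
  eq_iff : ∀ p q, d p q = 0 ↔ p = q
  leftInv : ∀ g p q, d (hmul g p) (hmul g q) = d p q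
  homog : ∀ l : ℝ, 0 < l → ∀ p q, d (hdil l p) (hdil l q) = l * d p q
  rotInv : ∀ p q : Hpt n,
    (∑ j, (p.1 j ^ 2 + p.2.1 j ^ 2)) = (∑ j, (q.1 j ^ 2 + q.2.1 j ^ 2)) →
    p.2.2 = q.2.2 → d 0 p = d 0 q
  carat : ∀ m : ℝ,
    (inferInstance : MeasurableSpace (Hpt n)) ≤ (sphOuter d m).caratheodory

/-- Open ball `U(p,r)` of a homogeneous distance. -/
def hball (D : HomDist n) (p : Hpt n) (r : ℝ) : Set (Hpt n) := rawBall D.d p r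

/-- The spherical Hausdorff measure `𝒮^m` of a homogeneous distance, as a measure. -/
def sphMeasure (D : HomDist n) (m : ℝ) : Measure (Hpt n) :=
  (sphOuter D.d m).toMeasure (D.carat m)

/-- `μ⌊A` is locally finite on `O`. -/
def LocFin (μ : Measure (Hpt n)) (A O : Set (Hpt n)) : Prop :=
  ∀ p ∈ O, ∃ U : Set (Hpt n), IsOpen U ∧ p ∈ U ∧ μ (A ∩ U) < ⊤

/-! ## Euclidean coordinates and Euclidean Hausdorff measures -/

/-- Realization of a coordinate vector `c ∈ ℝ^{2n+1}` as a point/tangent vector of `ℍⁿ`. -/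
def rE (c : Fin (2*n+1) → ℝ) : Hpt n :=
  (fun i => c ⟨(i:ℕ), by omega⟩, fun i => c ⟨n + (i:ℕ), by omega⟩, c ⟨2*n, by omega⟩)

/-- Coordinates of a point/tangent vector of `ℍⁿ` as a vector of `ℝ^{2n+1}`. -/
def toEc (q : Hpt n) : Fin (2*n+1) → ℝ := fun j =>
  if h : (j:ℕ) < n then q.1 ⟨j, h⟩
  else if h' : (j:ℕ) < 2*n then q.2.1 ⟨(j:ℕ) - n, by omega⟩
  else q.2.2

/-- Identification of `ℍⁿ` with the Euclidean space `ℝ^{2n+1}`. -/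
def ofE (q : EuclideanSpace ℝ (Fin (2*n+1))) : Hpt n := rE (fun j => q j)

/-- The `m`-dimensional Euclidean Hausdorff measure on `ℍⁿ ≡ ℝ^{2n+1}`. -/
def muE (n : ℕ) (m : ℝ) : Measure (Hpt n) :=
  Measure.map ofE (μH[m] : Measure (EuclideanSpace ℝ (Fin (2*n+1))))

/-! ## Multivectors -/

/-- Index sets for a basis of `Λ_k 𝔥`. -/
def IdxSet (n k : ℕ) := {s : Finset (Fin (2*n+1)) // s.card = k}

instance (n k : ℕ) : Fintype (IdxSet n k) := by unfold IdxSet; infer_instance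

/-- The increasing enumeration of an index set. -/
def idxTuple {k : ℕ} (s : IdxSet n k) (i : Fin k) : Fin (2*n+1) :=
  ((s.1.orderIsoOfFin s.2) i).1

/-- `k`-vectors, as coefficients with respect to the canonical basis of `Λ_k ℝ^{2n+1}`. -/
abbrev MVec (n k : ℕ) := IdxSet n k → ℝ

/-- The simple `k`-vector `v₁ ∧ ⋯ ∧ v_k`. -/
def simpleWedge {k : ℕ} (v : Fin k → (Fin (2*n+1) → ℝ)) : MVec n k :=
  fun s => Matrix.det (Matrix.of fun i j => v i (idxTuple s j))

/-- Degree cast for multivectors. -/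
def mvCast {a b : ℕ} (h : a = b) (t : MVec n a) : MVec n b :=
  fun s => t ⟨s.1, by rw [h]; exact s.2⟩

/-- Euclidean scalar product of coefficient vectors. -/
def dotC (a b : Fin (2*n+1) → ℝ) : ℝ := ∑ j, a j * b j

/-- Pairing `⟨t | η⟩` at `p` of a `k`-vector (in the left invariant frame `X₁,…,Yₙ,T`)
with a `k`-form. -/
def pairF {k : ℕ} (t : MVec n k) (p : Hpt n) (η : (Fin k → Hpt n) → ℝ) : ℝ :=
  ∑ s, t s * η (fun i => frameVec (idxTuple s i) p)

/-- The `j`-th coordinate basis vector of `ℝ^{2n+1}`. -/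
def coordC (j : Fin (2*n+1)) : Fin (2*n+1) → ℝ := fun j' => if j' = j then 1 else 0

/-- Pairing `⟨t | η⟩` of a `k`-vector (in the coordinate basis `∂x,∂y,∂t`) with a `k`-form. -/
def pairE {k : ℕ} (t : MVec n k) (η : (Fin k → Hpt n) → ℝ) : ℝ :=
  ∑ s, t s * η (fun i => rE (coordC (idxTuple s i)))

/-- Realization of a frame-coefficient vector as a tangent vector at `p`. -/
def rF (c : Fin (2*n+1) → ℝ) (p : Hpt n) : Hpt n := ∑ j, c j • frameVec j p

/-! ## Covectors and Heisenberg forms -/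

/-- `k`-covectors on `ℍⁿ`. -/
abbrev Cov (n k : ℕ) := AlternatingMap ℝ (Hpt n) ℝ (Fin k)

/-- Wedge product of covectors. -/
def cwedge {k l : ℕ} (α : Cov n k) (β : Cov n l) : Cov n (k + l) :=
  AlternatingMap.domDomCongr finSumFinEquiv
    ((TensorProduct.lid ℝ ℝ).toLinearMap.compAlternatingMap (AlternatingMap.domCoprod α β))

/-- Degree cast for covectors. -/
def covCast {a b : ℕ} (h : a = b) (α : Cov n a) : Cov n b :=
  AlternatingMap.domDomCongr (finCongr h) α

def projX (j : Fin n) : Hpt n →ₗ[ℝ] ℝ := (LinearMap.proj j).comp (LinearMap.fst ℝ _ _)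

def projY (j : Fin n) : Hpt n →ₗ[ℝ] ℝ :=
  (LinearMap.proj j).comp ((LinearMap.fst ℝ _ _).comp (LinearMap.snd ℝ _ _))

def projT : Hpt n →ₗ[ℝ] ℝ := (LinearMap.snd ℝ _ _).comp (LinearMap.snd ℝ _ _)

/-- The contact form `θ = dt + ½Σⱼ(yⱼdxⱼ − xⱼdyⱼ)` at `p`, as a linear functional. -/
def thetaLin (p : Hpt n) : Hpt n →ₗ[ℝ] ℝ :=
  projT + (2:ℝ)⁻¹ • (∑ j : Fin n, (p.2.1 j • projX j - p.1 j • projY j))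

/-- A linear functional as a `1`-covector. -/
def cov1 (L : Hpt n →ₗ[ℝ] ℝ) : Cov n 1 :=
  AlternatingMap.ofSubsingleton ℝ (Hpt n) ℝ (0 : Fin 1) L

/-- `θ` as a `1`-covector. -/
def thetaC (p : Hpt n) : Cov n 1 := cov1 (thetaLin p)

/-- `dθ = −Σⱼ dxⱼ∧dyⱼ` as a (constant) `2`-covector. -/
def dthetaC : Cov n 2 := -∑ j : Fin n, cwedge (cov1 (projX j)) (cov1 (projY j))

/-- Membership in the Rumin ideal `ℐ^k = {λ∧θ + μ∧dθ}` at the point `p`. -/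
def memI {k : ℕ} (p : Hpt n) (ω : Cov n k) : Prop :=
  ∃ (a : Cov n (k-1)) (ω₂ : Cov n k) (h1 : (k-1)+1 = k),
    ω = covCast h1 (cwedge a (thetaC p)) + ω₂ ∧
    (ω₂ = 0 ∨ ∃ (b : Cov n (k-2)) (h2 : (k-2)+2 = k), ω₂ = covCast h2 (cwedge b dthetaC))

/-- Membership in `𝒥^k = {λ : λ∧θ = λ∧dθ = 0}` at the point `p`. -/
def memJ {k : ℕ} (p : Hpt n) (ω : Cov n k) : Prop :=
  cwedge ω (thetaC p) = 0 ∧ cwedge ω dthetaC = 0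

/-- A compactly supported smooth Heisenberg `k`-form on `O` (for `k ≤ n` the values are
representatives of classes modulo `ℐ^k`; for `k ≥ n+1` they lie in `𝒥^k`). -/
structure IsHFormD (k : ℕ) (O : Set (Hpt n)) (ω : Hpt n → Cov n k) : Prop where
  smooth : ∀ v : Fin k → Hpt n, ContDiff ℝ (⊤ : ℕ∞) fun p => ω p v
  cptSupp : ∃ K : Set (Hpt n), IsCompact K ∧ K ⊆ O ∧ ∀ p ∉ K, ω p = 0
  vert : n + 1 ≤ k → ∀ p, memJ p (ω p)

/-- Exterior derivative (as a raw multilinear expression):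
`dω_p(v₀,…,v_k) = Σᵢ (−1)ⁱ ∂_{vᵢ}(q ↦ ω_q(v₀,…,v̂ᵢ,…,v_k))(p)`. -/
def extD {k : ℕ} (ω : Hpt n → Cov n k) (p : Hpt n) (v : Fin (k+1) → Hpt n) : ℝ :=
  ∑ i : Fin (k+1), (-1 : ℝ)^(i:ℕ) * fderiv ℝ (fun q => ω q (v ∘ i.succAbove)) p (v i)

/-- `η` is the Rumin operator `D` applied to `ω` (only meaningful in degree `k = n`):
`Dω = d(ω − θ∧β)` where `β = L⁻¹((dω)_{𝔥₁})`, i.e. `β` is horizontal and `β∧dθ` agrees with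
`dω` on horizontal vectors. -/
def IsRuminD {k : ℕ} (ω : Hpt n → Cov n k) (η : Hpt n → (Fin (k+1) → Hpt n) → ℝ) : Prop :=
  ∃ (β : Hpt n → Cov n (k-1)) (h1 : 1 + (k-1) = k) (h2 : (k-1)+2 = k+1),
    (∀ v, ContDiff ℝ (⊤ : ℕ∞) fun p => β p v) ∧
    (∀ (p : Hpt n) (v : Fin (k-1) → Hpt n) (i : Fin (k-1)),
      v i = ((0:Fin n → ℝ), (0:Fin n → ℝ), (1:ℝ)) → β p v = 0) ∧
    (∀ (p : Hpt n) (v : Fin (k+1) → Hpt n), (∀ i, thetaLin p (v i) = 0) →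
      extD ω p v = covCast h2 (cwedge (β p) dthetaC) v) ∧
    η = extD (fun p => ω p - covCast h1 (cwedge (thetaC p) (β p)))

/-- The Rumin differential `d_c`: the exterior derivative in degree `k ≠ n`, the second order
operator `D` in the critical degree `k = n`. -/
def IsDc {k : ℕ} (ω : Hpt n → Cov n k) (η : Hpt n → (Fin (k+1) → Hpt n) → ℝ) : Prop :=
  if k = n then IsRuminD ω η else η = extD ω

/-- Degree cast for raw forms. -/
def rawCast {a b : ℕ} (h : a = b) (η : (Fin a → Hpt n) → ℝ) : (Fin b → Hpt n) → ℝ :=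
  fun v => η (fun i => v (Fin.cast h i))

/-! ## Orientations and currents -/

/-- `t` is a unit tangent `m`-vector of the `k`-codimensional `C¹_ℍ` submanifold `S` at `p`,
i.e. `t = ±*n^ℍ_S(p)`: `t` is the wedge of an orthonormal basis of `ker d_ℍf_p`
(in the left invariant frame). -/
def IsHTangentVecAt (k m : ℕ) (S : Set (Hpt n)) (p : Hpt n) (t : MVec n m) : Prop :=
  ∃ (U : Set (Hpt n)) (f : Fin k → Hpt n → ℝ), IsOpen U ∧ p ∈ U ∧
    (∀ i, IsC1H U (f i)) ∧
    (∀ q ∈ U, LinearIndependent ℝ (fun i => gradH (f i) q)) ∧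
    S ∩ U = {q ∈ U | ∀ i, f i q = 0} ∧
    ∃ v : Fin m → (Fin (2*n+1) → ℝ),
      (∀ i j, dotC (v i) (v j) = if i = j then 1 else 0) ∧
      (∀ i l, dotC (v i) (gradF (f l) p) = 0) ∧
      t = simpleWedge v

/-- An orientation of a `k`-codimensional `C¹_ℍ` submanifold: a continuous global choice of
the unit tangent `(2n+1−k)`-vector `t^ℍ_S` (here of formal degree `m`). -/
def IsHOrient (k m : ℕ) (S : Set (Hpt n)) (t : Hpt n → MVec n m) : Prop :=
  ContinuousOn t S ∧ ∀ p ∈ S, IsHTangentVecAt k m S p (t p)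

/-- Classical Euclidean unit tangent `m`-vector at a point of an `m`-dimensional submanifold
(coefficients in the coordinate basis). -/
def IsEuclTangentVecAt (m : ℕ) (S : Set (Hpt n)) (p : Hpt n) (t : MVec n m) : Prop :=
  ∃ v : Fin m → (Fin (2*n+1) → ℝ),
    (∀ i j, dotC (v i) (v j) = if i = j then 1 else 0) ∧
    (∀ i, rE (v i) ∈ tangentConeAt ℝ S p) ∧ t = simpleWedge v

/-- Classical (Euclidean) orientation of a low-dimensional submanifold. -/
def IsEuclOrient (m : ℕ) (S : Set (Hpt n)) (t : Hpt n → MVec n m) : Prop :=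
  ContinuousOn t S ∧ ∀ p ∈ S, IsEuclTangentVecAt m S p (t p)

/-- The standard vertical subgroup `𝕎` of codimension `k`. -/
def Wstd (n k : ℕ) : Set (Hpt n) := {p | ∀ i : Fin n, (i:ℕ) < k → p.1 i = 0}

/-- Embedding realizing `𝕎` as a Euclidean space. -/
def wEmbed (n k : ℕ) (a : ({i : Fin n // k ≤ (i:ℕ)} → ℝ) × (Fin n → ℝ) × ℝ) : Hpt n :=
  (fun i => if h : k ≤ (i:ℕ) then a.1 ⟨i, h⟩ else 0, a.2.1, a.2.2)

/-- Lebesgue measure `ℒ^{2n+1−k}` on the vertical subgroup `𝕎`. -/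
def wLeb (n k : ℕ) : Measure (Hpt n) := Measure.map (wEmbed n k) volume

/-- The geometric constant
`C_{n,k} = (sup{ℒ^{2n+1−k}(𝕎 ∩ U(p,1)) : p ∈ U(0,1)})⁻¹`. -/
def CnkC (D : HomDist n) (k : ℕ) : ℝ :=
  (sSup {v : ℝ | ∃ p ∈ hball D 0 1, v = (wLeb n k (Wstd n k ∩ hball D p 1)).toReal})⁻¹

/-- The Heisenberg current `⟦S⟧` of an oriented `k`-codimensional (`k ≤ n`) submanifold:
`⟦S⟧(ω) = (1/C_{n,k}) ∫_S ⟨t^ℍ_S | ω⟩ d𝒮^{Q−k}`. -/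
def currF (D : HomDist n) (k : ℕ) (S : Set (Hpt n)) (t : Hpt n → MVec n (2*n+1-k))
    (η : Hpt n → (Fin (2*n+1-k) → Hpt n) → ℝ) : ℝ :=
  (CnkC D k)⁻¹ * ∫ p in S, pairF (t p) p (η p) ∂(sphMeasure D ((2*n+2 : ℝ) - (k : ℝ)))

/-- The current of an oriented low-dimensional (`m ≤ n`) submanifold: the classical integral
`⟦S⟧(ω) = ∫_S ⟨τ_S | ω⟩ d𝓗^m_E`. -/
def currE {n : ℕ} (m : ℕ) (S : Set (Hpt n)) (t : Hpt n → MVec n m)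
    (η : Hpt n → (Fin m → Hpt n) → ℝ) : ℝ :=
  ∫ p in S, pairE (t p) (η p) ∂(muE n (m : ℝ))

/-- The Heisenberg current of an oriented `m`-dimensional submanifold (any `m`). -/
def hCurr (D : HomDist n) (m : ℕ) (S : Set (Hpt n)) (t : Hpt n → MVec n m)
    (η : Hpt n → (Fin m → Hpt n) → ℝ) : ℝ :=
  if m ≤ n then currE m S t η
  else if h2 : m ≤ 2*n+1 then
    currF D (2*n+1-m) S (fun p => mvCast (by omega) (t p)) (fun p => rawCast (by omega) (η p))
  else 0

/-- Orientation of an `m`-dimensional submanifold (any `m`): Euclidean in low dimension,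
the continuous unit tangent field `t^ℍ_S` in low codimension. -/
def IsOrientS (m : ℕ) (S : Set (Hpt n)) (t : Hpt n → MVec n m) : Prop :=
  if m ≤ n then IsEuclOrient m S t else IsHOrient (2*n+1-m) m S t

/-! ## Submanifolds with boundary -/

/-- The boundary `∂S = S̄ ∖ S`. -/
def bdry (S : Set (Hpt n)) : Set (Hpt n) := closure S \ S

/-- `S` is a `k`-codimensional `C¹_ℍ`-regular submanifold with boundary in `O`. -/
def IsC1HSubWithBdry (D : HomDist n) (k : ℕ) (O : Set (Hpt n)) (S : Set (Hpt n)) : Prop :=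
  (O ∩ S).Nonempty ∧ IsC1HSub k (O ∩ S) ∧
  (O ∩ bdry S).Nonempty ∧ IsC1HSub (k+1) (O ∩ bdry S) ∧
  ∀ p ∈ O ∩ bdry S, ∃ U : Set (Hpt n), IsOpen U ∧ p ∈ U ∧
    ∃ S' : Set (Hpt n), S' ⊆ U ∧ IsC1HSub k S' ∧ U ∩ closure S ⊆ S' ∧
      ∀ r : ℝ, 0 < r → (hball D p r ∩ (S' \ closure S)).Nonempty

/-- A family `f₁,…,f_{k+1}` of local defining functions at a boundary point `p`, as in the
characterization of `k`-codimensional submanifolds with boundary: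
`U ∩ S = {f₁ = ⋯ = f_k = 0, f_{k+1} > 0}` and `f_{k+1}(p) = 0`. -/
def IsBdryFrame (k : ℕ) (S : Set (Hpt n)) (p : Hpt n) (U : Set (Hpt n))
    (f : Fin (k+1) → Hpt n → ℝ) : Prop :=
  IsOpen U ∧ p ∈ U ∧ (∀ i, IsC1H U (f i)) ∧
  (∀ q ∈ U, LinearIndependent ℝ (fun i => gradH (f i) q)) ∧
  U ∩ S = {q ∈ U | (∀ i : Fin k, f i.castSucc q = 0) ∧ 0 < f (Fin.last k) q} ∧
  f (Fin.last k) p = 0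

/-! ## Smooth and Euclidean submanifolds -/

/-- `S` is a smooth (Euclidean `C^∞`) submanifold of codimension `k`. -/
def IsSmoothCodim (k : ℕ) (S : Set (Hpt n)) : Prop :=
  ∀ p ∈ S, ∃ U : Set (Hpt n), IsOpen U ∧ p ∈ U ∧ ∃ f : Fin k → Hpt n → ℝ,
    (∀ i, ContDiff ℝ (⊤ : ℕ∞) (f i)) ∧
    (∀ q ∈ U, LinearIndependent ℝ (fun i => fderiv ℝ (f i) q)) ∧
    S ∩ U = {q ∈ U | ∀ i, f i q = 0}

/-- `S` is a Euclidean `C¹` submanifold of codimension `k`. -/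
def IsC1ECodim (k : ℕ) (S : Set (Hpt n)) : Prop :=
  ∀ p ∈ S, ∃ U : Set (Hpt n), IsOpen U ∧ p ∈ U ∧ ∃ f : Fin k → Hpt n → ℝ,
    (∀ i, ContDiff ℝ 1 (f i)) ∧
    (∀ q ∈ U, LinearIndependent ℝ (fun i => fderiv ℝ (f i) q)) ∧
    S ∩ U = {q ∈ U | ∀ i, f i q = 0}

/-- `M` is a Euclidean `k`-dimensional `C¹` submanifold with boundary (`M` closed in its
charts; boundary charts are half-spaces). -/
def IsC1EuclSubWithBdryDim (k : ℕ) (M : Set (Hpt n)) : Prop :=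
  ∀ p ∈ M, ∃ (V : Set (Fin k → ℝ)) (φ : (Fin k → ℝ) → Hpt n) (U : Set (Hpt n)) (a : Fin k → ℝ)
      (i₀ : Fin k),
    IsOpen V ∧ IsOpen U ∧ p ∈ U ∧ a ∈ V ∧ φ a = p ∧
    ContDiffOn ℝ 1 φ V ∧ Set.InjOn φ V ∧
    (∀ b ∈ V, Function.Injective (fderivWithin ℝ φ V b)) ∧
    (M ∩ U = φ '' (V ∩ {x | 0 ≤ x i₀}) ∨ M ∩ U = φ '' V)

/-! ## Isometries -/

/-- A rotation of the horizontal layer: a linear group automorphism commuting with dilations,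
preserving the vertical coordinate and the horizontal Euclidean norm. -/
def IsRotation (R : Hpt n → Hpt n) : Prop :=
  IsLinearMap ℝ R ∧ (∀ p q, R (hmul p q) = hmul (R p) (R q)) ∧
  (∀ l p, R (hdil l p) = hdil l (R p)) ∧
  (∀ p, (R p).2.2 = p.2.2) ∧
  (∀ p, (∑ j, ((R p).1 j ^ 2 + (R p).2.1 j ^ 2)) = ∑ j, (p.1 j ^ 2 + p.2.1 j ^ 2))

/-- An isometry of `ℍⁿ`: the composition of a left translation and a rotation. -/
def IsHIsom (φ : Hpt n → Hpt n) : Prop :=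
  ∃ (g : Hpt n) (R : Hpt n → Hpt n), IsRotation R ∧ φ = fun p => hmul g (R p)

/-! ## Tangent cones and blow-ups -/

/-- The tangent cone `T^ℍ_0 E` at the origin. -/
def tangentConeH (E : Set (Hpt n)) : Set (Hpt n) :=
  {x | ∃ (xh : ℕ → Hpt n) (rh : ℕ → ℝ), (∀ h, xh h ∈ E) ∧ Tendsto rh atTop atTop ∧
        Tendsto (fun h => hdil (rh h) (xh h)) atTop (𝓝 x)}

/-- The tangent cone `T^ℍ_p E = T^ℍ_0(p⁻¹ ⬝ E)`. -/
def tangentConeHAt (E : Set (Hpt n)) (p : Hpt n) : Set (Hpt n) :=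
  tangentConeH ((fun q => hmul (hinv p) q) '' E)

/-- Local Hausdorff convergence of the sets `F l` to `E` as `l → 0⁺`, with respect to the
homogeneous distance `D`. -/
def LocHausConv (D : HomDist n) (F : ℝ → Set (Hpt n)) (E : Set (Hpt n)) : Prop :=
  ∀ (c : Hpt n) (R ε : ℝ), 0 < R → 0 < ε → ∃ l0 : ℝ, 0 < l0 ∧ ∀ l : ℝ, 0 < l → l < l0 →
    (∀ x ∈ F l ∩ {q | D.d c q ≤ R}, ∃ e ∈ E, D.d x e < ε) ∧
    (∀ x ∈ E ∩ {q | D.d c q ≤ R}, ∃ y ∈ F l, D.d x y < ε)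

/-! ## Induced orientation on the boundary -/

/-- `tB` is the value at `p ∈ ∂S` of the orientation induced on `∂S` by the orientation `tS`
of the `m`-dimensional submanifold with boundary `S`. -/
def InducedBdryOrientAt (D : HomDist n) (m : ℕ) (S : Set (Hpt n)) (p : Hpt n)
    (tS : MVec n m) (tB : MVec n (m-1)) : Prop :=
  if m ≤ n then
    -- low dimension: classical Euclidean induced orientation via the outward normal
    ∃ (νc : Fin (2*n+1) → ℝ) (w : Fin (m-1) → (Fin (2*n+1) → ℝ)) (h : (m-1)+1 = m),
      (∀ i j : Fin ((m-1)+1), dotC (Matrix.vecCons νc w i) (Matrix.vecCons νc w j) = if i = j then 1 else 0) ∧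
      rE νc ∉ tangentConeAt ℝ (closure S) p ∧
      -(rE νc) ∈ tangentConeAt ℝ (closure S) p ∧
      (∀ i, rE (w i) ∈ tangentConeAt ℝ (bdry S) p) ∧
      tB = simpleWedge w ∧ tS = mvCast h (simpleWedge (Matrix.vecCons νc w))
  else if m = n+1 then
    -- critical codimension: `±T ∧ τ_{∂S} = t^ℍ_S` according to whether `S` lies below/above ∂S
    ∃ (U : Set (Hpt n)) (f : Fin n → Hpt n → ℝ), IsOpen U ∧ p ∈ U ∧
      (∀ i, IsC1H U (f i)) ∧ (∀ q ∈ U, LinearIndependent ℝ (fun i => gradH (f i) q)) ∧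
      U ∩ closure S ⊆ {q ∈ U | ∀ i, f i q = 0} ∧
      (∀ r : ℝ, 0 < r →
        (hball D p r ∩ ({q ∈ U | ∀ i, f i q = 0} \ closure S)).Nonempty) ∧
      ∃ (ε : ℝ) (w : Fin (m-1) → (Fin (2*n+1) → ℝ)) (h : (m-1)+1 = m),
        (ε = 1 ∨ ε = -1) ∧
        (∀ i j, dotC (w i) (w j) = if i = j then 1 else 0) ∧
        (∀ i, w i ⟨2*n, by omega⟩ = 0) ∧
        (∀ i, rF (w i) p ∈ tangentConeAt ℝ (bdry S) p) ∧
        -- `ε = −1` iff `S` lies above its boundary around `p`: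
        -- the blow-up of `S` at `p` is the corresponding open half of `T^ℍ_pS`
        LocHausConv D (fun l => (fun q => hdil l⁻¹ (hmul (hinv p) q)) '' S)
          ({v | ∀ i, pansuD (f i) p v = 0} ∩ {q | 0 < (-ε) * q.2.2}) ∧
        tB = simpleWedge (fun i => toEc (rF (w i) p)) ∧
        tS = mvCast h (simpleWedge (Matrix.vecCons (fun j => if (j:ℕ) = 2*n then ε else 0) w))
  else
    -- non-critical low codimension: `ν_{∂S} ∧ t^ℍ_{∂S} = t^ℍ_S` with `ν` the outward normal
    ∃ (U : Set (Hpt n)) (f : Fin (2*n+1-m+1) → Hpt n → ℝ),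
      IsBdryFrame (2*n+1-m) S p U f ∧
      ∃ (νc : Fin (2*n+1) → ℝ) (w : Fin (m-1) → (Fin (2*n+1) → ℝ)) (h : (m-1)+1 = m),
        (∀ i j : Fin ((m-1)+1), dotC (Matrix.vecCons νc w i) (Matrix.vecCons νc w j) = if i = j then 1 else 0) ∧
        (∀ i : Fin (2*n+1-m), pansuD (f i.castSucc) p (rE νc) = 0) ∧
        pansuD (f (Fin.last (2*n+1-m))) p (rE νc) < 0 ∧
        (∀ i, ∀ l : Fin (2*n+1-m+1), pansuD (f l) p (rE (w i)) = 0) ∧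
        tB = simpleWedge w ∧ tS = mvCast h (simpleWedge (Matrix.vecCons νc w))

/-! ## Miscellaneous -/

/-- The projection `π_p(q) = Σⱼ xⱼXⱼ(p) + Σⱼ yⱼYⱼ(p) ∈ H_pℍⁿ`. -/
def piProj (p q : Hpt n) : Hpt n :=
  (∑ j : Fin n, q.1 j • frameVec ⟨(j:ℕ), by omega⟩ p) +
  (∑ j : Fin n, q.2.1 j • frameVec ⟨n + (j:ℕ), by omega⟩ p)

/-- The norm `|·|_p` on the horizontal fibre `H_pℍⁿ` making `X₁(p),…,Yₙ(p)` orthonormal. -/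
def hnormAt (_p : Hpt n) (v : Hpt n) : ℝ :=
  Real.sqrt (∑ j, ((v.1 j) ^ 2 + (v.2.1 j) ^ 2))

/-- The left-invariant scalar product making `X₁,…,Yₙ,T` orthonormal. -/
def dotH (v w : Hpt n) : ℝ :=
  (∑ j, v.1 j * w.1 j) + (∑ j, v.2.1 j * w.2.1 j) + v.2.2 * w.2.2

/-! ## Horizontal vectors and calculus of `C¹_ℍ` functions -/

/-- The left invariant horizontal vector with coefficients `(a, b)` at the point `p`. -/
def hv (p : Hpt n) (a b : Fin n → ℝ) : Hpt n :=
  (a, b, (∑ j, p.1 j * b j) / 2 - (∑ j, a j * p.2.1 j) / 2)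

/-- `x`-coefficients of the `j`-th horizontal frame field. -/
def dA (j : Fin (2*n)) : Fin n → ℝ :=
  if h : (j : ℕ) < n then Pi.single (⟨j, h⟩ : Fin n) 1 else 0

/-- `y`-coefficients of the `j`-th horizontal frame field. -/
def dB (j : Fin (2*n)) : Fin n → ℝ :=
  if h : (j : ℕ) < n then 0 else Pi.single (⟨(j:ℕ) - n, by omega⟩ : Fin n) 1

/-- Pairing of the horizontal gradient with the horizontal vector of coefficients `(a, b)`. -/
def pD (f : Hpt n → ℝ) (p : Hpt n) (a b : Fin n → ℝ) : ℝ :=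
  ∑ j : Fin n, (a j * gradH f p ⟨(j:ℕ), by omega⟩ + b j * gradH f p ⟨n + (j:ℕ), by omega⟩)

lemma frameVec_eq (j : Fin (2*n)) (p : Hpt n) : frameVec (hIdx j) p = hv p (dA j) (dB j) := by
  unfold frameVec hv dA dB hIdx
  by_cases h : (j:ℕ) < n
  · simp only [Fin.val_castLE, h, dite_true]
    ext <;> simp [Pi.single_apply]
    ring
  · have h2 := j.2
    simp only [Fin.val_castLE, h, dite_false, h2, dite_true]
    ext <;> simp [Pi.single_apply]

lemma hv_line (p : Hpt n) (a b : Fin n → ℝ) (s : ℝ) : hv (p + s • hv p a b) a b = hv p a b := by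
  unfold hv
  ext <;> simp [add_mul, mul_add, Finset.sum_add_distrib]
  have : ∀ x : Fin n, a x * (s * b x) = s * a x * b x := fun x => by ring
  simp [this]
  ring

lemma hmul_line (g p : Hpt n) (a b : Fin n → ℝ) (s : ℝ) :
    hmul g (p + s • hv p a b) = hmul g p + s • hv (hmul g p) a b := by
  unfold hmul hv
  ext <;> simp [add_mul, mul_add, Finset.sum_add_distrib]
  · ring
  · ring
  · have h1 : ∀ x : Fin n, g.1 x * (s * b x) = s * (g.1 x * b x) := fun x => by ring
    have h2 : ∀ x : Fin n, s * a x * g.2.1 x = s * (a x * g.2.1 x) := fun x => by ring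
    simp only [h1, h2, ← Finset.mul_sum]
    ring

lemma pD_dir (f : Hpt n → ℝ) (p : Hpt n) (j : Fin (2*n)) : pD f p (dA j) (dB j) = gradH f p j := by
  unfold pD dA dB
  rw [Finset.sum_add_distrib]
  by_cases h : (j:ℕ) < n
  · simp [h, Pi.single_apply]
  · have h2 := j.2
    simp [h, Pi.single_apply]
    congr 1
    ext
    simp
    omega

lemma abs_pD_le {f : Hpt n → ℝ} {p : Hpt n} {M : ℝ} (hM : ∀ j, |gradH f p j| ≤ M)
    (a b : Fin n → ℝ) : |pD f p a b| ≤ (∑ j, (|a j| + |b j|)) * M := by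
  unfold pD
  rw [Finset.sum_mul]
  refine (Finset.abs_sum_le_sum_abs _ _).trans (Finset.sum_le_sum fun j _ => ?_)
  refine (abs_add_le _ _).trans ?_
  rw [abs_mul, abs_mul, add_mul]
  gcongr <;> exact hM _

lemma hasLine_iff {f : Hpt n → ℝ} {p w : Hpt n} {c : ℝ} :
    HasLineDerivAt ℝ f c p w ↔ HasDerivAt (fun s : ℝ => f (p + s • w)) c 0 := Iff.rfl

lemma IsC1H.hasLine {U : Set (Hpt n)} {f : Hpt n → ℝ} (hf : IsC1H U f) {p : Hpt n} (hp : p ∈ U)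
    (j : Fin (2*n)) : HasLineDerivAt ℝ f (gradH f p j) p (hv p (dA j) (dB j)) := by
  have h := (hf.ldiff p hp j).hasLineDerivAt
  rw [← frameVec_eq]
  exact h

lemma gradH_eq_of_hasLine {f : Hpt n → ℝ} {p : Hpt n} {j : Fin (2*n)} {c : ℝ}
    (h : HasLineDerivAt ℝ f c p (hv p (dA j) (dB j))) : gradH f p j = c := by
  unfold gradH
  rw [frameVec_eq]
  exact h.lineDeriv

lemma isC1H_of {U : Set (Hpt n)} {f : Hpt n → ℝ} (hc : ContinuousOn f U)
    (G : Fin (2*n) → Hpt n → ℝ)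
    (h : ∀ p ∈ U, ∀ j, HasLineDerivAt ℝ f (G j p) p (hv p (dA j) (dB j)))
    (hG : ∀ j, ContinuousOn (G j) U) : IsC1H U f := by
  refine ⟨hc, fun p hp j => ?_, fun j => ?_⟩
  · rw [frameVec_eq]
    exact (h p hp j).lineDifferentiableAt
  · exact (hG j).congr fun p hp => gradH_eq_of_hasLine (h p hp j)

lemma hasDerivAt_shift {f : Hpt n → ℝ} {p : Hpt n} {a b : Fin n → ℝ} {c s : ℝ}
    (h : HasLineDerivAt ℝ f c (p + s • hv p a b) (hv (p + s • hv p a b) a b)) :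
    HasDerivAt (fun r : ℝ => f (p + r • hv p a b)) c s := by
  rw [hv_line, hasLine_iff] at h
  have h2 := HasDerivAt.comp_sub_const (x := s) (a := s) (f := fun r : ℝ =>
    f (p + s • hv p a b + r • hv p a b)) (f' := c) (by simpa using h)
  refine h2.congr_of_eventuallyEq (Eventually.of_forall fun r => ?_)
  simp only [add_assoc, ← add_smul]
  congr 3
  ring

lemma IsC1H.mono {U V : Set (Hpt n)} {f : Hpt n → ℝ} (hf : IsC1H U f) (h : V ⊆ U) : IsC1H V f :=
  ⟨hf.contOn.mono h, fun _ hp => hf.ldiff _ (h hp), fun j => (hf.contGrad j).mono h⟩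

lemma hasLine_congr {f g : Hpt n → ℝ} {p w : Hpt n} {c : ℝ} (h : HasLineDerivAt ℝ f c p w)
    (hfg : g =ᶠ[𝓝 p] f) : HasLineDerivAt ℝ g c p w := by
  exact h.congr_of_eventuallyEq hfg

lemma isC1H_congr {U : Set (Hpt n)} (hU : IsOpen U) {f g : Hpt n → ℝ} (hf : IsC1H U f)
    (h : EqOn g f U) : IsC1H U g :=
  isC1H_of (hf.contOn.congr h) (fun j p => gradH f p j)
    (fun _ hp j => hasLine_congr (hf.hasLine hp j) (h.eventuallyEq_of_mem (hU.mem_nhds hp)))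
    hf.contGrad

lemma gradH_congr {f g : Hpt n → ℝ} {p : Hpt n} (h : f =ᶠ[𝓝 p] g) : gradH f p = gradH g p := by
  ext j
  unfold gradH
  exact h.lineDeriv_eq

lemma isC1H_union {U V : Set (Hpt n)} (hU : IsOpen U) (hV : IsOpen V) {f : Hpt n → ℝ}
    (hf : IsC1H U f) (hg : IsC1H V f) : IsC1H (U ∪ V) f := by
  refine ⟨hf.contOn.union_of_isOpen hg.contOn hU hV, ?_, fun j =>
    (hf.contGrad j).union_of_isOpen (hg.contGrad j) hU hV⟩
  rintro p (hp | hp) j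
  exacts [hf.ldiff p hp j, hg.ldiff p hp j]

lemma hasLine_smooth {f : Hpt n → ℝ} {p : Hpt n} (hf : DifferentiableAt ℝ f p) (w : Hpt n) :
    HasLineDerivAt ℝ f (fderiv ℝ f p w) p w := hf.hasFDerivAt.hasLineDerivAt w

lemma continuous_hv (a b : Fin n → ℝ) : Continuous fun p : Hpt n => hv p a b := by
  unfold hv; fun_prop

lemma isC1H_smooth {f : Hpt n → ℝ} (hf : ContDiff ℝ (⊤ : ℕ∞) f) : IsC1H univ f := by
  refine isC1H_of hf.continuous.continuousOn (fun j p => fderiv ℝ f p (hv p (dA j) (dB j)))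
    (fun p _ j => hasLine_smooth (hf.differentiable (by simp) p) _) (fun j => ?_)
  exact ((hf.continuous_fderiv (by simp)).clm_apply (continuous_hv _ _)).continuousOn

lemma hasLine_add {f g : Hpt n → ℝ} {p w : Hpt n} {c d : ℝ} (h : HasLineDerivAt ℝ f c p w)
    (h2 : HasLineDerivAt ℝ g d p w) : HasLineDerivAt ℝ (fun q => f q + g q) (c + d) p w :=
  HasDerivAt.add (hasLine_iff.1 h) (hasLine_iff.1 h2)

lemma hasLine_mul {f g : Hpt n → ℝ} {p w : Hpt n} {c d : ℝ} (h : HasLineDerivAt ℝ f c p w)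
    (h2 : HasLineDerivAt ℝ g d p w) :
    HasLineDerivAt ℝ (fun q => f q * g q) (c * g p + f p * d) p w := by
  have := HasDerivAt.mul (hasLine_iff.1 h) (hasLine_iff.1 h2)
  simpa using! this

lemma hasLine_cmul {f : Hpt n → ℝ} {p w : Hpt n} {c : ℝ} (r : ℝ) (h : HasLineDerivAt ℝ f c p w) :
    HasLineDerivAt ℝ (fun q => r * f q) (r * c) p w :=
  HasDerivAt.const_mul r (hasLine_iff.1 h)

lemma IsC1H.add {U : Set (Hpt n)} {f g : Hpt n → ℝ} (hf : IsC1H U f) (hg : IsC1H U g) :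
    IsC1H U (fun q => f q + g q) :=
  isC1H_of (hf.contOn.add hg.contOn) (fun j p => gradH f p j + gradH g p j)
    (fun _ hp j => hasLine_add (hf.hasLine hp j) (hg.hasLine hp j))
    (fun j => (hf.contGrad j).add (hg.contGrad j))

lemma IsC1H.mul {U : Set (Hpt n)} {f g : Hpt n → ℝ} (hf : IsC1H U f) (hg : IsC1H U g) :
    IsC1H U (fun q => f q * g q) :=
  isC1H_of (hf.contOn.mul hg.contOn) (fun j p => gradH f p j * g p + f p * gradH g p j)
    (fun _ hp j => hasLine_mul (hf.hasLine hp j) (hg.hasLine hp j))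
    (fun j => ((hf.contGrad j).mul hg.contOn).add (hf.contOn.mul (hg.contGrad j)))

lemma IsC1H.cmul {U : Set (Hpt n)} {f : Hpt n → ℝ} (hf : IsC1H U f) (r : ℝ) :
    IsC1H U (fun q => r * f q) :=
  isC1H_of (continuousOn_const.mul hf.contOn) (fun j p => r * gradH f p j)
    (fun _ hp j => hasLine_cmul r (hf.hasLine hp j))
    (fun j => continuousOn_const.mul (hf.contGrad j))

lemma gradH_add {U : Set (Hpt n)} {f g : Hpt n → ℝ} (hf : IsC1H U f) (hg : IsC1H U g) {p : Hpt n}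
    (hp : p ∈ U) (j : Fin (2*n)) : gradH (fun q => f q + g q) p j = gradH f p j + gradH g p j :=
  gradH_eq_of_hasLine (hasLine_add (hf.hasLine hp j) (hg.hasLine hp j))

lemma gradH_mul {U : Set (Hpt n)} {f g : Hpt n → ℝ} (hf : IsC1H U f) (hg : IsC1H U g) {p : Hpt n}
    (hp : p ∈ U) (j : Fin (2*n)) :
    gradH (fun q => f q * g q) p j = gradH f p j * g p + f p * gradH g p j :=
  gradH_eq_of_hasLine (hasLine_mul (hf.hasLine hp j) (hg.hasLine hp j))

lemma gradH_cmul {U : Set (Hpt n)} {f : Hpt n → ℝ} (hf : IsC1H U f) (r : ℝ) {p : Hpt n}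
    (hp : p ∈ U) (j : Fin (2*n)) : gradH (fun q => r * f q) p j = r * gradH f p j :=
  gradH_eq_of_hasLine (hasLine_cmul r (hf.hasLine hp j))

lemma isC1H_sum {ι : Type*} {U : Set (Hpt n)} {f : ι → Hpt n → ℝ} (s : Finset ι)
    (hf : ∀ i ∈ s, IsC1H U (f i)) : IsC1H U (fun q => ∑ i ∈ s, f i q) ∧
      ∀ p ∈ U, ∀ j, gradH (fun q => ∑ i ∈ s, f i q) p j = ∑ i ∈ s, gradH (f i) p j := by
  have key : ∀ p ∈ U, ∀ j, HasLineDerivAt ℝ (fun q => ∑ i ∈ s, f i q)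
      (∑ i ∈ s, gradH (f i) p j) p (hv p (dA j) (dB j)) := fun p hp j => by
    rw [hasLine_iff]
    exact HasDerivAt.fun_sum fun i hi => (hf i hi).hasLine hp j
  exact ⟨isC1H_of (continuousOn_finsetSum _ fun i hi => (hf i hi).contOn)
    (fun j p => ∑ i ∈ s, gradH (f i) p j) key
    (fun j => continuousOn_finsetSum _ fun i hi => (hf i hi).contGrad j),
    fun p hp j => gradH_eq_of_hasLine (key p hp j)⟩


/-! ## Smoothing by left convolution -/

lemma continuous_hmul : Continuous fun x : Hpt n × Hpt n => hmul x.1 x.2 := by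
  unfold hmul; fun_prop

lemma contDiff_hmul : ContDiff ℝ (⊤ : ℕ∞) fun x : Hpt n × Hpt n => hmul x.1 x.2 := by
  unfold hmul; fun_prop

lemma contDiff_hinv : ContDiff ℝ (⊤ : ℕ∞) (hinv : Hpt n → Hpt n) := by
  unfold hinv; fun_prop

lemma hmul_hinv_cancel_right (p q : Hpt n) : hmul (hmul p q) (hinv q) = p := by
  unfold hmul hinv
  ext <;> simp [add_mul, mul_add, Finset.sum_add_distrib]
  have : ∀ x : Fin n, q.1 x * q.2.1 x = q.2.1 x * q.1 x := fun x => mul_comm _ _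
  ring

lemma hmul_hinv_cancel_right2 (p q : Hpt n) : hmul (hmul p (hinv q)) q = p := by
  unfold hmul hinv
  ext <;> simp [add_mul, mul_add, Finset.sum_add_distrib]
  ring

lemma zero_hmul (q : Hpt n) : hmul 0 q = q := by
  unfold hmul
  ext <;> simp

lemma measurePreserving_hmul_right (q : Hpt n) :
    MeasurePreserving (fun g : Hpt n => hmul g q) volume volume := by
  have h1 : ∀ x : Fin n → ℝ, MeasurePreserving (fun z : (Fin n → ℝ) × ℝ => (z.1 + q.2.1,
      z.2 + (q.2.2 + (∑ j, x j * q.2.1 j) / 2 - (∑ j, q.1 j * z.1 j) / 2)))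
      (volume.prod volume) (volume.prod volume) := fun x => by
    refine MeasurePreserving.skew_product (measurePreserving_add_right volume q.2.1)
      (g := fun (y : Fin n → ℝ) (t : ℝ) =>
        t + (q.2.2 + (∑ j, x j * q.2.1 j) / 2 - (∑ j, q.1 j * y j) / 2)) ?_ ?_
    · apply Continuous.measurable
      unfold Function.uncurry
      fun_prop
    · exact Eventually.of_forall fun y => (measurePreserving_add_right volume _).map_eq
  have h2 := MeasurePreserving.skew_product (measurePreserving_add_right volume q.1)
      (g := fun (x : Fin n → ℝ) (z : (Fin n → ℝ) × ℝ) => (z.1 + q.2.1,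
      z.2 + (q.2.2 + (∑ j, x j * q.2.1 j) / 2 - (∑ j, q.1 j * z.1 j) / 2)))
      (μc := volume.prod volume) (μd := volume.prod volume) (by
        apply Continuous.measurable
        unfold Function.uncurry
        fun_prop) (Eventually.of_forall fun x => (h1 x).map_eq)
  have h3 : (fun g : Hpt n => hmul g q) = fun p : (Fin n → ℝ) × (Fin n → ℝ) × ℝ =>
      (p.1 + q.1, (p.2.1 + q.2.1,
      p.2.2 + (q.2.2 + (∑ j, p.1 j * q.2.1 j) / 2 - (∑ j, q.1 j * p.2.1 j) / 2))) := by
    funext g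
    refine Prod.ext rfl (Prod.ext rfl ?_)
    simp only [hmul]
    ring
  rw [h3]
  exact h2

/-- Left convolution with a kernel. -/
def moll (r : Hpt n → ℝ) (f : Hpt n → ℝ) (q : Hpt n) : ℝ := ∫ h, r h * f (hmul h q)

lemma moll_eq (r f : Hpt n → ℝ) (q : Hpt n) :
    moll r f q = ∫ g, f g * r (hmul g (hinv q)) := by
  have hm := measurePreserving_hmul_right q
  have hme : MeasurableEmbedding (fun g : Hpt n => hmul g q) := by
    have c1 : Continuous fun g : Hpt n => hmul g q := by unfold hmul; fun_prop
    have c2 : Continuous fun g : Hpt n => hmul g (hinv q) := by unfold hmul; fun_prop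
    exact (Homeomorph.mk (Equiv.mk (fun g : Hpt n => hmul g q) (fun g => hmul g (hinv q))
      (fun g => hmul_hinv_cancel_right g q) (fun g => hmul_hinv_cancel_right2 g q)) c1
      c2).measurableEmbedding
  rw [← hm.integral_comp hme]
  unfold moll
  congr 1
  ext g
  rw [hmul_hinv_cancel_right, mul_comm]

lemma contDiff_moll {r f : Hpt n → ℝ} (hr : ContDiff ℝ (⊤ : ℕ∞) r)
    (hr0 : ∀ h, h ∉ Metric.closedBall (0 : Hpt n) 1 → r h = 0) (hf : Continuous f) :
    ContDiff ℝ (⊤ : ℕ∞) (moll r f) := by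
  rw [contDiff_iff_contDiffAt]
  intro q
  set K : Set (Hpt n) := (fun x : Hpt n × Hpt n => - hmul x.1 x.2) ''
    (Metric.closedBall 0 1 ×ˢ Metric.closedBall q 1) with hK
  have hKc : IsCompact K :=
    ((isCompact_closedBall _ _).prod (isCompact_closedBall _ _)).image continuous_hmul.neg
  have key := contDiffOn_convolution_right_with_param_comp (μ := (volume : Measure (Hpt n)))
    (𝕜 := ℝ) (n := ⊤)
    (ContinuousLinearMap.mul ℝ ℝ) (s := Metric.ball q 1) (v := fun _ : Hpt n => (0 : Hpt n))
    contDiffOn_const (f := f) (g := fun (p : Hpt n) (z : Hpt n) => r (hmul (-z) (hinv p)))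
    (k := K) Metric.isOpen_ball hKc ?_ hf.locallyIntegrable ?_
  · refine (key.contDiffAt (Metric.ball_mem_nhds q one_pos)).congr_of_eventuallyEq
      (Eventually.of_forall fun p => ?_)
    rw [moll_eq]
    simp [convolution]
  · intro p x hp hx
    apply hr0
    intro hmem
    apply hx
    refine ⟨(hmul (-x) (hinv p), p), ⟨hmem, Metric.ball_subset_closedBall hp⟩, ?_⟩
    simp [hmul_hinv_cancel_right2]
  · apply ContDiff.contDiffOn
    have : ContDiff ℝ (⊤ : ℕ∞) (fun x : Hpt n × Hpt n => r (hmul (-x.2) (hinv x.1))) :=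
      hr.comp (contDiff_hmul.comp ((contDiff_snd.neg).prodMk (contDiff_hinv.comp contDiff_fst)))
    exact this

lemma hasLine_moll {r f : Hpt n → ℝ} (hr : ContDiff ℝ (⊤ : ℕ∞) r)
    (hr0 : ∀ h, h ∉ Metric.closedBall (0 : Hpt n) 1 → r h = 0) (hf : IsC1H univ f) (q : Hpt n)
    (j : Fin (2*n)) :
    HasLineDerivAt ℝ (moll r f) (moll r (fun p => gradH f p j) q) q (hv q (dA j) (dB j)) := by
  rw [hasLine_iff]
  have hfc : Continuous f := continuousOn_univ.1 hf.contOn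
  have hgc : Continuous fun p => gradH f p j := continuousOn_univ.1 (hf.contGrad j)
  have hrc := hr.continuous
  set w := hv q (dA j) (dB j) with hw
  have hsupp : HasCompactSupport r := HasCompactSupport.intro (isCompact_closedBall 0 1) hr0
  have hmc : ∀ p : Hpt n, Continuous fun h : Hpt n => hmul h p := fun p => by
    unfold hmul; fun_prop
  obtain ⟨M, hM⟩ : ∃ M, ∀ x ∈ Metric.closedBall (0 : Hpt n) 1 ×ˢ Set.Icc (-1:ℝ) 1,
      ‖gradH f (hmul x.1 (q + x.2 • w)) j‖ ≤ M :=
    ((isCompact_closedBall _ _).prod isCompact_Icc).exists_bound_of_continuousOn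
      (hgc.comp (continuous_hmul.comp (continuous_fst.prodMk
        (continuous_const.add (continuous_snd.smul continuous_const))))).continuousOn
  have key := hasDerivAt_integral_of_dominated_loc_of_deriv_le (μ := (volume : Measure (Hpt n)))
    (F := fun (s : ℝ) (h : Hpt n) => r h * f (hmul h (q + s • w)))
    (F' := fun (s : ℝ) (h : Hpt n) => r h * gradH f (hmul h (q + s • w)) j)
    (x₀ := 0) (s := Set.Ioo (-1:ℝ) 1) (bound := fun h => ‖r h‖ * M)
    (Ioo_mem_nhds (by norm_num) (by norm_num))
    (Eventually.of_forall fun s => (hrc.mul (hfc.comp (hmc _))).aestronglyMeasurable)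
    ((hrc.mul (hfc.comp (hmc _))).integrable_of_hasCompactSupport hsupp.mul_right)
    (hrc.mul (hgc.comp (hmc _))).aestronglyMeasurable
    (Eventually.of_forall fun h s hs => ?_)
    ((hrc.norm.mul continuous_const).integrable_of_hasCompactSupport hsupp.norm.mul_right)
    (Eventually.of_forall fun h s hs => ?_)
  · have := key.2
    simp only [zero_smul, add_zero] at this
    exact this
  · by_cases hh : h ∈ Metric.closedBall (0 : Hpt n) 1
    · rw [norm_mul]
      gcongr
      exact hM (h, s) ⟨hh, Ioo_subset_Icc_self hs⟩
    · simp [hr0 h hh]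
  · apply HasDerivAt.const_mul
    simp only [hw, hmul_line]
    exact hasDerivAt_shift (hf.hasLine (mem_univ _) j)

lemma unif_small {F : Hpt n → ℝ} (hF : Continuous F) {K : Set (Hpt n)} (hK : IsCompact K)
    {ε : ℝ} (hε : 0 < ε) : ∀ᶠ h in 𝓝 (0 : Hpt n), ∀ q ∈ K, |F (hmul h q) - F q| < ε := by
  have hc : Continuous fun x : Hpt n × Hpt n => |F (hmul x.1 x.2) - F x.2| :=
    ((hF.comp continuous_hmul).sub (hF.comp continuous_snd)).abs
  have := hK.eventually_forall_of_forall_eventually (x₀ := (0 : Hpt n))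
    (P := fun h q => |F (hmul h q) - F q| < ε) (fun q _ => ?_)
  · exact this
  · apply hc.continuousAt.eventually_lt continuousAt_const
    simp [zero_hmul, hε]

lemma moll_close {F r : Hpt n → ℝ} (hF : Continuous F) (hr : Continuous r) {ρ ε : ℝ}
    (hr0 : ∀ h, h ∉ Metric.closedBall (0 : Hpt n) ρ → r h = 0) (hrn : ∀ h, 0 ≤ r h)
    (hr1 : ∫ h, r h = 1) {q : Hpt n}
    (hq : ∀ h ∈ Metric.closedBall (0 : Hpt n) ρ, |F (hmul h q) - F q| ≤ ε) :
    |moll r F q - F q| ≤ ε := by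
  have hsupp : HasCompactSupport r := HasCompactSupport.intro (isCompact_closedBall 0 ρ) hr0
  have hmc : Continuous fun h : Hpt n => hmul h q := by
    unfold hmul; fun_prop
  have e1 : moll r F q - F q = ∫ h, r h * (F (hmul h q) - F q) := by
    simp only [mul_sub]
    rw [integral_sub, integral_mul_const, hr1, one_mul]
    · rfl
    · exact (hr.mul (hF.comp hmc)).integrable_of_hasCompactSupport hsupp.mul_right
    · exact (hr.mul continuous_const).integrable_of_hasCompactSupport hsupp.mul_right
  rw [e1, ← Real.norm_eq_abs]
  calc ‖∫ h, r h * (F (hmul h q) - F q)‖ ≤ ∫ h, r h * ε := by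
        refine norm_integral_le_of_norm_le ?_ (Eventually.of_forall fun h => ?_)
        · exact (hr.mul continuous_const).integrable_of_hasCompactSupport hsupp.mul_right
        · by_cases hh : h ∈ Metric.closedBall (0 : Hpt n) ρ
          · rw [norm_mul, Real.norm_of_nonneg (hrn h)]
            exact mul_le_mul_of_nonneg_left (hq h hh) (hrn h)
          · simp [hr0 h hh]
    _ = ε := by rw [integral_mul_const, hr1, one_mul]

/-- Smooth approximation of `C¹_ℍ` functions, locally uniformly with horizontal gradients. -/
lemma exists_smooth_approx {f : Hpt n → ℝ} (hf : IsC1H univ f) {K : Set (Hpt n)}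
    (hK : IsCompact K) {ε : ℝ} (hε : 0 < ε) :
    ∃ g : Hpt n → ℝ, ContDiff ℝ (⊤ : ℕ∞) g ∧ (∀ q ∈ K, |g q - f q| ≤ ε) ∧
      ∀ q ∈ K, ∀ j, |gradH g q j - gradH f q j| ≤ ε := by
  have hfc : Continuous f := continuousOn_univ.1 hf.contOn
  have hgc : ∀ j, Continuous fun p => gradH f p j := fun j => continuousOn_univ.1 (hf.contGrad j)
  have h1 := unif_small hfc hK hε
  have h2 := eventually_all.2 fun j => unif_small (hgc j) hK hε
  obtain ⟨δ, hδ, hball⟩ := Metric.eventually_nhds_iff_ball.1 (h1.and h2)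
  set d := min δ 1 with hd
  have hdpos : 0 < d := lt_min hδ one_pos
  let φ : ContDiffBump (0 : Hpt n) := ⟨d / 4, d / 2, by positivity, by linarith⟩
  set r : Hpt n → ℝ := φ.normed volume with hr
  have hrs : ContDiff ℝ (⊤ : ℕ∞) r := φ.contDiff_normed
  have hr0 : ∀ h, h ∉ Metric.closedBall (0 : Hpt n) (d/2) → r h = 0 := fun h hh => by
    have : Function.support r = Metric.ball (0 : Hpt n) (d/2) := φ.support_normed_eq
    by_contra hne
    have hm : h ∈ Function.support r := hne
    rw [this] at hm
    exact hh (Metric.ball_subset_closedBall hm)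
  have hsub : Metric.closedBall (0 : Hpt n) (d/2) ⊆ Metric.closedBall 0 1 :=
    Metric.closedBall_subset_closedBall (by have := min_le_right δ 1; linarith)
  have hsub2 : Metric.closedBall (0 : Hpt n) (d/2) ⊆ Metric.ball 0 δ :=
    Metric.closedBall_subset_ball (by have := min_le_left δ 1; linarith)
  have hr0' : ∀ h, h ∉ Metric.closedBall (0 : Hpt n) 1 → r h = 0 := fun h hh =>
    hr0 h fun hc => hh (hsub hc)
  refine ⟨moll r f, contDiff_moll hrs hr0' hfc, fun q hq => ?_, fun q hq j => ?_⟩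
  · exact moll_close hfc hrs.continuous hr0 (fun h => φ.nonneg_normed h) φ.integral_normed
      fun h hh => ((hball h (hsub2 hh)).1 q hq).le
  · rw [gradH_eq_of_hasLine (hasLine_moll hrs hr0' hf q j)]
    exact moll_close (hgc j) hrs.continuous hr0 (fun h => φ.nonneg_normed h) φ.integral_normed
      fun h hh => ((hball h (hsub2 hh)).2 j q hq).le


/-! ## Cut-offs and derivatives in general horizontal directions -/

lemma isC1H_cutoff {U C : Set (Hpt n)} (hU : IsOpen U) (hC : IsClosed C) (hCU : C ⊆ U)
    {χ f : Hpt n → ℝ} (hχ : ContDiff ℝ (⊤ : ℕ∞) χ) (hχ0 : ∀ q, q ∉ C → χ q = 0)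
    (hf : IsC1H U f) : IsC1H univ (fun q => χ q * f q) := by
  have h1 : IsC1H U (fun q => χ q * f q) := ((isC1H_smooth hχ).mono (subset_univ _)).mul hf
  have h2 : IsC1H Cᶜ (fun q => χ q * f q) := by
    refine isC1H_congr hC.isOpen_compl
      ((isC1H_smooth (contDiff_const (c := (0:ℝ)))).mono (subset_univ _)) fun q hq => ?_
    simp [hχ0 q hq]
  refine (isC1H_union hU hC.isOpen_compl h1 h2).mono fun q _ => ?_
  by_cases hq : q ∈ C
  · exact Or.inl (hCU hq)
  · exact Or.inr hq

lemma exists_global {U : Set (Hpt n)} (hU : IsOpen U) {f : Hpt n → ℝ} (hf : IsC1H U f)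
    {p : Hpt n} (hp : p ∈ U) : ∃ F : Hpt n → ℝ, IsC1H univ F ∧ F =ᶠ[𝓝 p] f := by
  obtain ⟨ε, hε, hball⟩ := Metric.isOpen_iff.1 hU p hp
  let φ : ContDiffBump p := ⟨ε / 4, ε / 2, by positivity, by linarith⟩
  refine ⟨fun q => φ q * f q, isC1H_cutoff hU Metric.isClosed_closedBall
    (C := Metric.closedBall p (ε/2))
    ((Metric.closedBall_subset_ball (by linarith)).trans hball) φ.contDiff (fun q hq => ?_) hf, ?_⟩
  · apply φ.zero_of_le_dist
    have := mt Metric.mem_closedBall.2 hq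
    exact (not_le.1 this).le
  · filter_upwards [φ.eventuallyEq_one] with q hq
    rw [hq]
    simp

lemma dA_X (j : Fin n) : dA (⟨(j:ℕ), by omega⟩ : Fin (2*n)) = Pi.single j 1 := by
  simp [dA]

lemma dB_X (j : Fin n) : dB (⟨(j:ℕ), by omega⟩ : Fin (2*n)) = 0 := by
  simp [dB]

lemma dA_Y (j : Fin n) : dA (⟨n + (j:ℕ), by omega⟩ : Fin (2*n)) = 0 := by
  simp [dA]

lemma dB_Y (j : Fin n) : dB (⟨n + (j:ℕ), by omega⟩ : Fin (2*n)) = Pi.single j 1 := by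
  simp [dB]

lemma hv_decomp (p : Hpt n) (a b : Fin n → ℝ) :
    hv p a b = ∑ j, (a j • hv p (Pi.single j 1) 0 + b j • hv p 0 (Pi.single j 1)) := by
  unfold hv
  refine Prod.ext ?_ (Prod.ext ?_ ?_)
  · rw [Prod.fst_sum]
    ext i
    simp [Finset.sum_apply, Pi.single_apply]
  · rw [Prod.snd_sum, Prod.fst_sum]
    ext i
    simp [Finset.sum_apply, Pi.single_apply]
  · rw [Prod.snd_sum, Prod.snd_sum]
    simp [Pi.single_apply, Finset.sum_add_distrib, Finset.sum_div, mul_comm]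
    rw [sub_eq_add_neg, add_comm]
    congr 1
    · rw [neg_inj]
      exact Finset.sum_congr rfl fun i _ => by ring
    · exact Finset.sum_congr rfl fun i _ => by ring

lemma gradH_smooth {g : Hpt n → ℝ} {p : Hpt n} (hg : DifferentiableAt ℝ g p) (j : Fin (2*n)) :
    gradH g p j = fderiv ℝ g p (hv p (dA j) (dB j)) :=
  gradH_eq_of_hasLine (hasLine_smooth hg _)

lemma fderiv_hv {g : Hpt n → ℝ} {p : Hpt n} (hg : DifferentiableAt ℝ g p) (a b : Fin n → ℝ) :
    fderiv ℝ g p (hv p a b) = pD g p a b := by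
  rw [hv_decomp, map_sum]
  unfold pD
  refine Finset.sum_congr rfl fun j _ => ?_
  rw [gradH_smooth hg, gradH_smooth hg, dA_X, dB_X, dA_Y, dB_Y]
  simp

lemma abs_pD_sub_le {f g : Hpt n → ℝ} {p : Hpt n} {M : ℝ}
    (hM : ∀ j, |gradH f p j - gradH g p j| ≤ M)
    (a b : Fin n → ℝ) : |pD f p a b - pD g p a b| ≤ (∑ j, (|a j| + |b j|)) * M := by
  unfold pD
  rw [Finset.sum_mul, ← Finset.sum_sub_distrib]
  refine (Finset.abs_sum_le_sum_abs _ _).trans (Finset.sum_le_sum fun j _ => ?_)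
  have : ∀ x y z w u v : ℝ, x * y + z * w - (x * u + z * v) = x * (y - u) + z * (w - v) := by
    intros; ring
  rw [this]
  refine (abs_add_le _ _).trans ?_
  rw [abs_mul, abs_mul, add_mul]
  gcongr <;> exact hM _

lemma hasLine_gen {U : Set (Hpt n)} (hU : IsOpen U) {f : Hpt n → ℝ} (hf : IsC1H U f)
    {p : Hpt n} (hp : p ∈ U) (a b : Fin n → ℝ) :
    HasLineDerivAt ℝ f (pD f p a b) p (hv p a b) := by
  obtain ⟨F, hF, hFf⟩ := exists_global hU hf hp
  have hpD : pD f p a b = pD F p a b := by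
    unfold pD
    rw [gradH_congr hFf]
  rw [hpD]
  refine hasLine_congr ?_ hFf.symm
  rw [hasLine_iff]
  set w := hv p a b with hw
  have hK : IsCompact ((fun s : ℝ => p + s • w) '' Set.Icc (-1) 1) :=
    isCompact_Icc.image (by fun_prop)
  have hpos : ∀ m : ℕ, (0:ℝ) < 1 / ((m:ℝ) + 1) := fun m => by positivity
  choose g hg1 hg2 hg3 using fun m : ℕ => exists_smooth_approx hF hK (hpos m)
  have hlim : Tendsto (fun m : ℕ => 1 / ((m:ℝ) + 1)) atTop (𝓝 0) :=
    tendsto_one_div_add_atTop_nhds_zero_nat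
  have key := hasDerivAt_of_tendstoUniformlyOn (l := atTop) (isOpen_Ioo (a := (-1:ℝ)) (b := 1))
    (f := fun (m : ℕ) (s : ℝ) => g m (p + s • w)) (g := fun s => F (p + s • w))
    (f' := fun m s => pD (g m) (p + s • w) a b) (g' := fun s => pD F (p + s • w) a b)
    (x := 0) ?_ (Eventually.of_forall fun m s hs => ?_) (fun s hs => ?_) (by norm_num)
  · simpa using key
  · rw [Metric.tendstoUniformlyOn_iff]
    intro ε hε
    set c := ∑ j, (|a j| + |b j|) with hc
    have : Tendsto (fun m : ℕ => c * (1 / ((m:ℝ) + 1))) atTop (𝓝 (c * 0)) := hlim.const_mul c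
    rw [mul_zero] at this
    filter_upwards [this.eventually_lt_const hε] with m hm s hs
    rw [dist_comm, Real.dist_eq]
    refine lt_of_le_of_lt (abs_pD_sub_le (fun j => ?_) a b) hm
    exact hg3 m _ ⟨s, Ioo_subset_Icc_self hs, rfl⟩ j
  · apply hasDerivAt_shift
    rw [← fderiv_hv ((hg1 m).differentiable (by simp) _)]
    exact hasLine_smooth ((hg1 m).differentiable (by simp) _) _
  · rw [tendsto_iff_dist_tendsto_zero]
    refine squeeze_zero (fun _ => dist_nonneg) (fun m => ?_) hlim
    rw [Real.dist_eq]
    exact hg2 m _ ⟨s, Ioo_subset_Icc_self hs, rfl⟩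

/-- Mean value estimate on horizontal segments. -/
lemma seg_estimate {U : Set (Hpt n)} (hU : IsOpen U) {f : Hpt n → ℝ} (hf : IsC1H U f)
    {p : Hpt n} {a b : Fin n → ℝ} {M : ℝ} {B : Set (Hpt n)} (hBc : Convex ℝ B) (hBU : B ⊆ U)
    (hM : ∀ q ∈ B, ∀ j, |gradH f q j| ≤ M) (hp : p ∈ B) (hp2 : p + hv p a b ∈ B) :
    |f (p + hv p a b) - f p| ≤ (∑ j, (|a j| + |b j|)) * M := by
  have hmem : ∀ s ∈ Set.Icc (0:ℝ) 1, p + s • hv p a b ∈ B := fun s hs =>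
    hBc.add_smul_mem hp hp2 hs
  have := norm_image_sub_le_of_norm_deriv_le_segment_01' (f := fun s : ℝ => f (p + s • hv p a b))
    (f' := fun s => pD f (p + s • hv p a b) a b) (C := (∑ j, (|a j| + |b j|)) * M)
    (fun s hs => (hasDerivAt_shift (hasLine_gen hU hf (hBU (hmem s hs)) a b)).hasDerivWithinAt)
    (fun s hs => abs_pD_le (hM _ (hmem s (Ico_subset_Icc_self hs))) a b)
  simpa using this

/-! ## Isometries -/

lemma isRot_t0 {R : Hpt n → Hpt n} (hR : IsRotation R) (a b : Fin n → ℝ) :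
    R (a, b, 0) = ((R (a, b, 0)).1, (R (a, b, 0)).2.1, 0) := by
  refine Prod.ext rfl (Prod.ext rfl ?_)
  exact hR.2.2.2.1 _

lemma hmul_hv (p : Hpt n) (a b : Fin n → ℝ) : p + hv p a b = hmul p (a, b, 0) := by
  unfold hv hmul
  refine Prod.ext rfl (Prod.ext rfl ?_)
  simp
  ring

lemma hmul_assoc' (p q r : Hpt n) : hmul (hmul p q) r = hmul p (hmul q r) := by
  unfold hmul
  refine Prod.ext (add_assoc _ _ _) (Prod.ext (add_assoc _ _ _) ?_)
  simp [add_mul, mul_add, Finset.sum_add_distrib]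
  ring

lemma isom_line {g : Hpt n} {R : Hpt n → Hpt n} (hR : IsRotation R) (q : Hpt n)
    (a b : Fin n → ℝ) (s : ℝ) : hmul g (R (q + s • hv q a b)) =
      hmul g (R q) + s • hv (hmul g (R q)) (R (a, b, 0)).1 (R (a, b, 0)).2.1 := by
  rw [← hmul_line]
  congr 1
  have hl := hR.1
  rw [hl.map_add, hl.map_smul]
  have h1 : R (q + hv q a b) = R q + hv (R q) (R (a, b, 0)).1 (R (a, b, 0)).2.1 := by
    rw [hmul_hv, hR.2.1, isRot_t0 hR, ← hmul_hv]
  rw [hl.map_add] at h1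
  rw [add_left_cancel h1]

lemma isRot_continuous {R : Hpt n → Hpt n} (hR : IsRotation R) : Continuous R :=
  (IsLinearMap.mk' R hR.1).continuous_of_finiteDimensional

lemma isRot_injective {R : Hpt n → Hpt n} (hR : IsRotation R) : Function.Injective R := by
  change Function.Injective (IsLinearMap.mk' R hR.1)
  rw [injective_iff_map_eq_zero]
  intro p hp
  change R p = 0 at hp
  have h1 := hR.2.2.2.1 p
  have h2 := hR.2.2.2.2 p
  rw [hp] at h1 h2
  simp at h1 h2
  have h3 := (Finset.sum_eq_zero_iff_of_nonneg (fun j _ => by positivity)).1 h2.symm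
  refine Prod.ext ?_ (Prod.ext ?_ h1.symm)
  · ext j
    have := h3 j (Finset.mem_univ _)
    simp; nlinarith [sq_nonneg (p.1 j), sq_nonneg (p.2.1 j)]
  · ext j
    have := h3 j (Finset.mem_univ _)
    simp; nlinarith [sq_nonneg (p.1 j), sq_nonneg (p.2.1 j)]

lemma hmul_left_injective (g : Hpt n) : Function.Injective (hmul g) := by
  intro p q h
  have : ∀ p : Hpt n, hmul (hinv g) (hmul g p) = p := fun p => by
    rw [← hmul_assoc']
    have : hmul (hinv g) g = 0 := by
      unfold hmul hinv
      refine Prod.ext (by simp) (Prod.ext (by simp) ?_)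
      simp
    rw [this, zero_hmul]
  rw [← this p, h, this]

lemma hasLine_isom {g : Hpt n} {R : Hpt n → Hpt n} (hR : IsRotation R) {U : Set (Hpt n)}
    (hU : IsOpen U) {f : Hpt n → ℝ} (hf : IsC1H U f) {q : Hpt n} (hq : hmul g (R q) ∈ U)
    (a b : Fin n → ℝ) : HasLineDerivAt ℝ (fun q => f (hmul g (R q)))
      (pD f (hmul g (R q)) (R (a, b, 0)).1 (R (a, b, 0)).2.1) q (hv q a b) := by
  rw [hasLine_iff]
  simp only [isom_line hR]
  exact hasLine_gen hU hf hq _ _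

lemma isC1H_isom {g : Hpt n} {R : Hpt n → Hpt n} (hR : IsRotation R) {U : Set (Hpt n)}
    (hU : IsOpen U) {f : Hpt n → ℝ} (hf : IsC1H U f) :
    IsC1H ((fun q => hmul g (R q)) ⁻¹' U) (fun q => f (hmul g (R q))) := by
  have hc : Continuous fun q => hmul g (R q) :=
    continuous_hmul.comp (continuous_const.prodMk (isRot_continuous hR))
  refine isC1H_of (hf.contOn.comp hc.continuousOn (mapsTo_preimage _ _))
    (fun j q => pD f (hmul g (R q)) (R (dA j, dB j, 0)).1 (R (dA j, dB j, 0)).2.1)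
    (fun q hq j => hasLine_isom hR hU hf hq _ _) fun j => ?_
  unfold pD
  refine continuousOn_finsetSum _ fun i _ => ContinuousOn.add ?_ ?_ <;>
  · refine continuousOn_const.mul ?_
    exact (hf.contGrad _).comp hc.continuousOn (mapsTo_preimage _ _)

lemma pD_isom {g : Hpt n} {R : Hpt n → Hpt n} (hR : IsRotation R) {U : Set (Hpt n)}
    (hU : IsOpen U) {f : Hpt n → ℝ} (hf : IsC1H U f) {q : Hpt n} (hq : hmul g (R q) ∈ U)
    (a b : Fin n → ℝ) : pD (fun q => f (hmul g (R q))) q a b =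
      pD f (hmul g (R q)) (R (a, b, 0)).1 (R (a, b, 0)).2.1 := by
  have hc : Continuous fun q => hmul g (R q) :=
    continuous_hmul.comp (continuous_const.prodMk (isRot_continuous hR))
  exact (hasLine_gen (hU.preimage hc) (isC1H_isom hR hU hf) hq a b).unique
    (hasLine_isom hR hU hf hq a b)


/-! ## Smoothing away from the zero set -/

lemma isC1H_tsum {F : ℕ → Hpt n → ℝ} (hF : ∀ m, IsC1H univ (F m)) {u v : ℕ → ℝ}
    (hu : Summable u) (hv0 : Summable v) (h1 : ∀ m q, |F m q| ≤ v m)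
    (h2 : ∀ m q j, |gradH (F m) q j| ≤ u m) :
    IsC1H univ (fun q => ∑' m, F m q) ∧
      ∀ q j, gradH (fun q => ∑' m, F m q) q j = ∑' m, gradH (F m) q j := by
  have key : ∀ q j, HasLineDerivAt ℝ (fun q => ∑' m, F m q) (∑' m, gradH (F m) q j) q
      (hv q (dA j) (dB j)) := fun q j => by
    rw [hasLine_iff]
    have := hasDerivAt_tsum hu (g := fun m (s : ℝ) => F m (q + s • hv q (dA j) (dB j)))
      (g' := fun m s => gradH (F m) (q + s • hv q (dA j) (dB j)) j) (y₀ := 0)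
      (fun m s => hasDerivAt_shift ((hF m).hasLine (mem_univ _) j))
      (fun m s => h2 m _ j) (Summable.of_norm_bounded hv0 fun m => h1 m _) 0
    simpa using this
  refine ⟨isC1H_of ?_ (fun j q => ∑' m, gradH (F m) q j) (fun q _ j => key q j) fun j => ?_,
    fun q j => gradH_eq_of_hasLine (key q j)⟩
  · exact (continuous_tsum (fun m => continuousOn_univ.1 (hF m).contOn) hv0
      fun m q => h1 m q).continuousOn
  · exact (continuous_tsum (fun m => continuousOn_univ.1 ((hF m).contGrad j)) hu
      fun m q => h2 m q j).continuousOn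

lemma exists_partition {Ω : Set (Hpt n)} (hΩ : IsOpen Ω) :
    ∃ (χ : ℕ → Hpt n → ℝ) (K : ℕ → Set (Hpt n)), (∀ m, ContDiff ℝ (⊤ : ℕ∞) (χ m)) ∧
      (∀ m q, 0 ≤ χ m q ∧ χ m q ≤ 1) ∧ (∀ q, χ 0 q = 0) ∧ (∀ m, IsCompact (K m)) ∧
      (∀ m, K m ⊆ Ω) ∧ (∀ m q, q ∉ K m → χ (m+1) q = 0 ∧ χ m q = 0) ∧
      ∀ q ∈ Ω, ∃ M : ℕ, ∀ᶠ q' in 𝓝 q, ∀ m ≥ M, χ m q' = 1 := by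
  obtain ⟨σ, hσs, hσd, hσr⟩ := hΩ.exists_contDiff_support_eq (n := (⊤ : ℕ∞))
  have hσ0 : ∀ q, 0 ≤ σ q := fun q => (hσr ⟨q, rfl⟩).1
  let φ : ℕ → ContDiffBump (0 : Hpt n) := fun m => ⟨m + 1, m + 2, by positivity, by linarith⟩
  refine ⟨fun m q => Real.smoothTransition (m * σ q - 1) * φ m q,
    fun m => Metric.closedBall 0 (m + 3) ∩ {q | 1 ≤ ((m:ℝ) + 1) * σ q}, fun m => ?_,
    fun m q => ⟨?_, ?_⟩, fun q => ?_, fun m => ?_, fun m q hq => ?_, fun m q hq => ?_,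
    fun q hq => ?_⟩
  · refine ContDiff.mul ?_ (φ m).contDiff
    exact Real.smoothTransition.contDiff.comp ((contDiff_const.mul hσd).sub contDiff_const)
  · exact mul_nonneg (Real.smoothTransition.nonneg _) (φ m).nonneg
  · exact mul_le_one₀ (Real.smoothTransition.le_one _) (φ m).nonneg (φ m).le_one
  · simp only [Nat.cast_zero, zero_mul]
    rw [Real.smoothTransition.zero_of_nonpos (by norm_num), zero_mul]
  · refine (isCompact_closedBall _ _).inter_right ?_
    exact isClosed_le continuous_const (continuous_const.mul hσd.continuous)
  · rw [← hσs]
    intro h0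
    have h1 : 1 ≤ ((m:ℝ) + 1) * σ q := hq.2
    rw [h0] at h1
    norm_num at h1
  · by_cases hb : q ∈ Metric.closedBall (0 : Hpt n) (m + 3)
    · have h1 : ((m:ℝ) + 1) * σ q < 1 := by
        by_contra hcon
        exact hq ⟨hb, not_lt.1 hcon⟩
      have h2 := hσ0 q
      constructor
      · beta_reduce
        rw [Real.smoothTransition.zero_of_nonpos (by push_cast; linarith), zero_mul]
      · beta_reduce
        rw [Real.smoothTransition.zero_of_nonpos (by linarith), zero_mul]
    · have h1 : (m:ℝ) + 3 < dist q 0 := not_le.1 (mt Metric.mem_closedBall.2 hb)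
      constructor
      · beta_reduce
        rw [(φ (m+1)).zero_of_le_dist (by
          change ((m+1 : ℕ):ℝ) + 2 ≤ dist q 0
          push_cast; linarith), mul_zero]
      · beta_reduce
        rw [(φ m).zero_of_le_dist (by
          change (m:ℝ) + 2 ≤ dist q 0
          linarith), mul_zero]
  · rw [← hσs] at hq
    have hpos : 0 < σ q := lt_of_le_of_ne (hσ0 q) (Ne.symm hq)
    obtain ⟨M1, hM1⟩ := exists_nat_gt (4 / σ q)
    obtain ⟨M2, hM2⟩ := exists_nat_gt (dist q 0)
    refine ⟨max M1 M2, ?_⟩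
    have e1 : ∀ᶠ q' in 𝓝 q, σ q / 2 < σ q' :=
      continuousAt_const.eventually_lt hσd.continuous.continuousAt (by linarith)
    have e2 : ∀ᶠ q' in 𝓝 q, dist q' 0 < M2 :=
      (continuous_id.dist continuous_const).continuousAt.eventually_lt continuousAt_const hM2
    filter_upwards [e1, e2] with q' h1 h2 m hm
    have hm1 : (M1:ℝ) ≤ m := by exact_mod_cast (le_max_left _ _).trans hm
    have hm2 : (M2:ℝ) ≤ m := by exact_mod_cast (le_max_right _ _).trans hm
    rw [Real.smoothTransition.one_of_one_le, (φ m).one_of_mem_closedBall, one_mul]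
    · rw [Metric.mem_closedBall]
      change dist q' 0 ≤ (m:ℝ) + 1
      linarith
    · have h3 : 4 / σ q < m := lt_of_lt_of_le hM1 hm1
      rw [div_lt_iff₀ hpos] at h3
      have h4 : (0:ℝ) ≤ m := by positivity
      nlinarith

lemma smooth_off {k : ℕ} (f : Fin k → Hpt n → ℝ) (hf : ∀ i, IsC1H univ (f i)) {ε : ℝ}
    (hε : 0 < ε) : ∃ h : Fin k → Hpt n → ℝ, (∀ i, IsC1H univ (h i)) ∧
      (∀ i q j, |gradH (h i) q j| ≤ ε) ∧ (∀ i q, |h i q| ≤ ‖fun i => f i q‖ / 2) ∧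
      ∀ i, ContDiffOn ℝ (⊤ : ℕ∞) (fun q => f i q + h i q) {q | ¬ ∀ i', f i' q = 0} := by
  have hfc : ∀ i, Continuous (f i) := fun i => continuousOn_univ.1 (hf i).contOn
  have hN : Continuous fun q => ‖fun i => f i q‖ := (continuous_pi hfc).norm
  set Ω : Set (Hpt n) := {q | ¬ ∀ i', f i' q = 0} with hΩdef
  have hΩ0 : ∀ q, q ∈ Ω ↔ 0 < ‖fun i => f i q‖ := fun q => by
    rw [norm_pos_iff, hΩdef, Set.mem_ofPred_eq, not_iff_not, funext_iff]
    rfl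
  have hΩ : IsOpen Ω := by
    have : Ω = {q | 0 < ‖fun i => f i q‖} := Set.ext hΩ0
    rw [this]
    exact isOpen_lt continuous_const hN
  obtain ⟨χ, K, hχs, hχ01, hχ0, hKc, hKΩ, hχK, hχ1⟩ := exists_partition hΩ
  set ψ : ℕ → Hpt n → ℝ := fun m q => χ (m+1) q - χ m q with hψ
  have hψs : ∀ m, ContDiff ℝ (⊤ : ℕ∞) (ψ m) := fun m => (hχs (m+1)).sub (hχs m)
  have hψ1 : ∀ m q, |ψ m q| ≤ 1 := fun m q => by
    have h1 := hχ01 m q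
    have h2 := hχ01 (m+1) q
    rw [abs_le]
    constructor <;> simp only [hψ] <;> linarith
  have hψK : ∀ m q, q ∉ K m → ψ m q = 0 := fun m q hq => by
    simp [hψ, hχK m q hq]
  have hψC : ∀ m, IsC1H univ (ψ m) := fun m => isC1H_smooth (hψs m)
  have hC : ∀ m, ∃ C, ∀ q ∈ K m, ‖gradH (ψ m) q‖ ≤ C := fun m =>
    (hKc m).exists_bound_of_continuousOn
      (continuous_pi fun j => continuousOn_univ.1 ((hψC m).contGrad j)).continuousOn
  choose C hC using hC
  have hc : ∀ m, ∃ c, 0 < c ∧ ∀ q ∈ K m, c ≤ ‖fun i => f i q‖ := fun m =>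
    (hKc m).exists_forall_le' hN.continuousOn fun q hq => (hΩ0 q).1 (hKΩ m hq)
  choose c hcpos hc using hc
  set δ : ℕ → ℝ := fun m => min (c m / 2) ε / 2 / 2 ^ m / (1 + |C m|) with hδ
  have hδpos : ∀ m, 0 < δ m := fun m => by
    have := lt_min (half_pos (hcpos m)) hε
    have h2 : (0:ℝ) < 1 + |C m| := by positivity
    simp only [hδ]
    positivity
  choose g hgs hg1 hg2 using fun (i : Fin k) (m : ℕ) => exists_smooth_approx (hf i) (hKc m) (hδpos m)
  set F : Fin k → ℕ → Hpt n → ℝ := fun i m q => ψ m q * (g i m q + (-1) * f i q) with hF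
  have hdC : ∀ i m, IsC1H univ (fun q => g i m q + (-1) * f i q) := fun i m =>
    (isC1H_smooth (hgs i m)).add ((hf i).cmul (-1))
  have hFC : ∀ i m, IsC1H univ (F i m) := fun i m => (hψC m).mul (hdC i m)
  have hδ1 : ∀ m, (1 + |C m|) * δ m = min (c m / 2) ε / 2 / 2 ^ m := fun m => by
    have h2 : (1 + |C m|) ≠ 0 := by positivity
    simp only [hδ]
    field_simp
  have hδ2 : ∀ m, δ m ≤ min (c m / 2) ε / 2 / 2 ^ m := fun m => by
    rw [← hδ1]
    have := abs_nonneg (C m)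
    have := hδpos m
    nlinarith
  have hFb0 : ∀ i m q, q ∈ K m → |F i m q| ≤ δ m := fun i m q hq => by
    have h1 := hg1 i m q hq
    have h2 := hψ1 m q
    simp only [hF]
    rw [abs_mul]
    have h3 : g i m q + (-1) * f i q = g i m q - f i q := by ring
    rw [h3]
    calc _ ≤ 1 * δ m := mul_le_mul h2 h1 (abs_nonneg _) zero_le_one
      _ = δ m := one_mul _
  have hF0 : ∀ i m q, q ∉ K m → F i m q = 0 := fun i m q hq => by
    simp [hF, hψK m q hq]
  have hFb1 : ∀ i m q, |F i m q| ≤ ‖fun i => f i q‖ / 2 / 2 / 2 ^ m := fun i m q => by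
    by_cases hq : q ∈ K m
    · refine (hFb0 i m q hq).trans ((hδ2 m).trans ?_)
      gcongr
      exact (min_le_left _ _).trans (div_le_div_of_nonneg_right (hc m q hq) zero_le_two)
    · rw [hF0 i m q hq, abs_zero]
      positivity
  have hFb2 : ∀ i m q, |F i m q| ≤ ε / 2 / 2 ^ m := fun i m q => by
    by_cases hq : q ∈ K m
    · refine (hFb0 i m q hq).trans ((hδ2 m).trans ?_)
      gcongr
      exact min_le_right _ _
    · rw [hF0 i m q hq, abs_zero]
      positivity
  have hFg : ∀ i m q j, |gradH (F i m) q j| ≤ ε / 2 / 2 ^ m := fun i m q j => by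
    by_cases hq : q ∈ K m
    · have e1 : gradH (F i m) q j = gradH (ψ m) q j * (g i m q - f i q) +
          ψ m q * (gradH (g i m) q j - gradH (f i) q j) := by
        have := gradH_mul (hψC m) (hdC i m) (mem_univ q) j
        rw [gradH_add (isC1H_smooth (hgs i m)) ((hf i).cmul (-1)) (mem_univ q),
          gradH_cmul (hf i) (-1) (mem_univ q)] at this
        rw [show gradH (F i m) q j = _ from this]
        ring
      have h0 : |gradH (ψ m) q j| ≤ |C m| :=
        ((norm_le_pi_norm (gradH (ψ m) q) j).trans (hC m q hq)).trans (le_abs_self _)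
      rw [e1]
      calc _ ≤ |C m| * δ m + 1 * δ m := by
            refine (abs_add_le _ _).trans ?_
            rw [abs_mul, abs_mul]
            exact add_le_add (mul_le_mul h0 (hg1 i m q hq) (abs_nonneg _) (abs_nonneg _))
              (mul_le_mul (hψ1 m q) (hg2 i m q hq j) (abs_nonneg _) zero_le_one)
        _ = min (c m / 2) ε / 2 / 2 ^ m := by rw [← hδ1]; ring
        _ ≤ _ := by
            gcongr
            exact min_le_right _ _
    · have : F i m =ᶠ[𝓝 q] fun _ => 0 := by
        filter_upwards [(hKc m).isClosed.isOpen_compl.mem_nhds hq] with q' hq'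
        exact hF0 i m q' hq'
      rw [gradH_congr this]
      have : gradH (fun _ : Hpt n => (0:ℝ)) q j = 0 := by
        simp [gradH, lineDeriv]
      rw [this, abs_zero]
      positivity
  have hT := fun i => isC1H_tsum (hFC i) (summable_geometric_two' ε) (summable_geometric_two' ε)
    (hFb2 i) (hFg i)
  refine ⟨fun i q => ∑' m, F i m q, fun i => (hT i).1, fun i q j => ?_, fun i q => ?_,
    fun i q hq => ?_⟩
  · rw [(hT i).2, ← Real.norm_eq_abs]
    exact tsum_of_norm_bounded (hasSum_geometric_two' ε) fun m => hFg i m q j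
  · rw [← Real.norm_eq_abs]
    exact tsum_of_norm_bounded (hasSum_geometric_two' _) fun m => hFb1 i m q
  · apply ContDiffAt.contDiffWithinAt
    obtain ⟨M, hM⟩ := hχ1 q hq
    have hs : ContDiffAt ℝ (⊤ : ℕ∞) (fun q => ∑ m ∈ Finset.range M, ψ m q * g i m q) q :=
      (ContDiff.sum fun m _ => (hψs m).mul (hgs i m)).contDiffAt
    refine hs.congr_of_eventuallyEq ?_
    filter_upwards [hM] with q' hq'
    have e1 : ∑' m, F i m q' = ∑ m ∈ Finset.range M, F i m q' := by
      apply tsum_eq_sum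
      intro m hm
      have hm' : M ≤ m := by simpa using hm
      simp [hF, hψ, hq' m hm', hq' (m+1) (by omega)]
    have e2 : ∑ m ∈ Finset.range M, ψ m q' = 1 := by
      rw [Finset.sum_range_sub (fun m => χ m q'), hχ0, hq' M le_rfl, sub_zero]
    rw [e1]
    have e3 : ∀ m, F i m q' = ψ m q' * g i m q' - ψ m q' * f i q' := fun m => by
      simp only [hF]; ring
    simp only [e3, Finset.sum_sub_distrib, ← Finset.sum_mul, e2]
    ring


/-! ## Globalization of a defining function by cut-off -/

lemma hdil_line (r : ℝ) (p : Hpt n) (a b : Fin n → ℝ) (s : ℝ) :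
    hdil r (p + s • hv p a b) = hdil r p + (r * s) • hv (hdil r p) a b := by
  unfold hdil hv
  refine Prod.ext ?_ (Prod.ext ?_ ?_)
  · ext i; simp; ring
  · ext i; simp; ring
  · simp
    have h1 : ∀ x : Fin n, r * p.1 x * b x = r * (p.1 x * b x) := fun x => by ring
    have h2 : ∀ x : Fin n, a x * (r * p.2.1 x) = r * (a x * p.2.1 x) := fun x => by ring
    simp only [h1, h2, ← Finset.mul_sum]
    ring

lemma continuous_hdil (r : ℝ) : Continuous (hdil (n := n) r) := by
  unfold hdil; fun_prop

lemma hasLine_dil (r : ℝ) {U : Set (Hpt n)} {f : Hpt n → ℝ} (hf : IsC1H U f) {q : Hpt n}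
    (hq : hdil r q ∈ U) (j : Fin (2*n)) : HasLineDerivAt ℝ (fun q => f (hdil r q))
      (r * gradH f (hdil r q) j) q (hv q (dA j) (dB j)) := by
  rw [hasLine_iff]
  simp only [hdil_line]
  have h1 := hasLine_iff.1 (hf.hasLine hq j)
  have h2 : HasDerivAt (fun s : ℝ => r * s) r 0 := by
    simpa using (hasDerivAt_id (0:ℝ)).const_mul r
  have h3 := HasDerivAt.comp (0:ℝ) (h₂ := fun s : ℝ => f (hdil r q + s • hv (hdil r q) (dA j) (dB j)))
    (h := fun s : ℝ => r * s) (h₂' := gradH f (hdil r q) j) (by simpa using h1) h2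
  rw [mul_comm]
  exact h3

lemma isC1H_dil (r : ℝ) {U : Set (Hpt n)} {f : Hpt n → ℝ} (hf : IsC1H U f) :
    IsC1H (hdil r ⁻¹' U) (fun q => f (hdil r q)) :=
  isC1H_of (hf.contOn.comp (continuous_hdil r).continuousOn (mapsTo_preimage _ _))
    (fun j q => r * gradH f (hdil r q) j) (fun _ hq j => hasLine_dil r hf hq j)
    fun j => continuousOn_const.mul
      ((hf.contGrad j).comp (continuous_hdil r).continuousOn (mapsTo_preimage _ _))

lemma gradH_dil (r : ℝ) {U : Set (Hpt n)} {f : Hpt n → ℝ} (hf : IsC1H U f) {q : Hpt n}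
    (hq : hdil r q ∈ U) (j : Fin (2*n)) :
    gradH (fun q => f (hdil r q)) q j = r * gradH f (hdil r q) j :=
  gradH_eq_of_hasLine (hasLine_dil r hf hq j)

lemma mem_cball {q : Hpt n} {c : ℝ} (hc : 0 ≤ c) : q ∈ Metric.closedBall (0 : Hpt n) c ↔
    (∀ j, |q.1 j| ≤ c) ∧ (∀ j, |q.2.1 j| ≤ c) ∧ |q.2.2| ≤ c := by
  rw [mem_closedBall_zero_iff, Prod.norm_def, Prod.norm_def, max_le_iff, max_le_iff,
    pi_norm_le_iff_of_nonneg hc, pi_norm_le_iff_of_nonneg hc]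
  rfl

lemma box_estimate (hn : 1 ≤ n) {U : Set (Hpt n)} (hU : IsOpen U) {v : Hpt n → ℝ}
    (hv1 : IsC1H U v) (hBU : Metric.closedBall 0 4 ⊆ U) (h0 : v 0 = 0) {M : ℝ}
    (hM : ∀ q ∈ Metric.closedBall (0 : Hpt n) 4, ∀ j, |gradH v q j| ≤ M) {q : Hpt n}
    (hq : q ∈ Metric.closedBall (0 : Hpt n) 1) : |v q| ≤ (2 * n + 6) * M := by
  have hM0 : 0 ≤ M := (abs_nonneg _).trans
    (hM 0 (Metric.mem_closedBall_self (by norm_num)) ⟨0, by omega⟩)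
  have est := fun (p : Hpt n) (a b : Fin n → ℝ) hp hp2 =>
    seg_estimate (p := p) (a := a) (b := b) hU hv1 (convex_closedBall 0 4) hBU hM hp hp2
  obtain ⟨x, y, t⟩ := q
  obtain ⟨hx, hy, ht⟩ := (mem_cball zero_le_one).1 hq
  simp only at hx hy ht
  let e : Fin n := ⟨0, by omega⟩
  let p1 : Hpt n := (x, y, 0)
  let p2 : Hpt n := (x + Pi.single e 2, y, - y e)
  let p3 : Hpt n := (x + Pi.single e 2, y + Pi.single e t, - y e + (x e + 2) * t / 2)
  have e1 : p1 = 0 + hv (0 : Hpt n) x y := by simp [p1, hv]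
  have e2 : p2 = p1 + hv p1 (Pi.single e 2) 0 := by
    refine Prod.ext (by simp [p1, p2, hv]) (Prod.ext (by simp [p1, p2, hv]) ?_)
    simp [p1, p2, hv, Pi.single_apply]
  have e3 : p3 = p2 + hv p2 0 (Pi.single e t) := by
    refine Prod.ext (by simp [p3, p2, hv]) (Prod.ext (by simp [p3, p2, hv]) ?_)
    simp [p3, p2, hv, Pi.single_apply]
  have e4 : ((x, y, t) : Hpt n) = p3 + hv p3 (Pi.single e (-2)) (Pi.single e (-t)) := by
    refine Prod.ext (by simp [p3, hv, Pi.single_neg]) (Prod.ext (by simp [p3, hv, Pi.single_neg]) ?_)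
    simp [p3, hv, Pi.single_apply]
    ring
  have hs : ∀ (z : Fin n → ℝ) (c d : ℝ), (∀ j, |z j| ≤ 1) → |c| ≤ d → ∀ j,
      |(z + Pi.single e c : Fin n → ℝ) j| ≤ 1 + d := fun z c d hz hc j => by
    rw [Pi.add_apply, Pi.single_apply]
    refine (abs_add_le _ _).trans (add_le_add (hz j) ?_)
    split_ifs
    · exact hc
    · simpa using (abs_nonneg _).trans hc
  have hxe := abs_le.1 (hx e)
  have hye := abs_le.1 (hy e)
  have ht' := abs_le.1 ht
  have m0 : (0 : Hpt n) ∈ Metric.closedBall (0 : Hpt n) 4 :=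
    Metric.mem_closedBall_self (by norm_num)
  have m1 : p1 ∈ Metric.closedBall (0 : Hpt n) 4 := by
    rw [mem_cball (by norm_num)]
    exact ⟨fun j => (hx j).trans (by norm_num), fun j => (hy j).trans (by norm_num), by simp [p1]⟩
  have m2 : p2 ∈ Metric.closedBall (0 : Hpt n) 4 := by
    rw [mem_cball (by norm_num)]
    refine ⟨fun j => (hs x 2 2 hx (by norm_num) j).trans (by norm_num),
      fun j => (hy j).trans (by norm_num), ?_⟩
    simp only [p2]
    rw [abs_le]
    constructor <;> linarith
  have m3 : p3 ∈ Metric.closedBall (0 : Hpt n) 4 := by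
    rw [mem_cball (by norm_num)]
    refine ⟨fun j => (hs x 2 2 hx (by norm_num) j).trans (by norm_num),
      fun j => (hs y t 1 hy ht j).trans (by norm_num), ?_⟩
    simp only [p3]
    rw [abs_le]
    constructor <;> nlinarith
  have m4 : ((x, y, t) : Hpt n) ∈ Metric.closedBall (0 : Hpt n) 4 :=
    Metric.closedBall_subset_closedBall (by norm_num) hq
  have d1 := est 0 x y m0 (e1 ▸ m1)
  have d2 := est p1 _ _ m1 (e2 ▸ m2)
  have d3 := est p2 _ _ m2 (e3 ▸ m3)
  have d4 := est p3 _ _ m3 (e4 ▸ m4)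
  rw [← e1, h0] at d1
  rw [← e2] at d2
  rw [← e3] at d3
  rw [← e4] at d4
  have abs_single : ∀ c : ℝ, ∑ j, |(Pi.single e c : Fin n → ℝ) j| = |c| := fun c => by
    rw [Finset.sum_eq_single e]
    · simp
    · intro j _ hj
      simp [hj]
    · simp
  simp only [Finset.sum_add_distrib, abs_single, Pi.zero_apply, abs_zero, Finset.sum_const_zero,
    abs_neg, Nat.abs_ofNat, add_zero, zero_add] at d1 d2 d3 d4
  have s1 : ∑ j, |x j| ≤ n := by
    simpa using Finset.sum_le_sum (s := Finset.univ) fun j _ => hx j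
  have s2 : ∑ j, |y j| ≤ n := by
    simpa using Finset.sum_le_sum (s := Finset.univ) fun j _ => hy j
  have d1' : |v p1 - 0| ≤ (n + n) * M := d1.trans (by gcongr)
  have d3' : |v p3 - v p2| ≤ 1 * M := d3.trans (by gcongr)
  have d4' : |v (x, y, t) - v p3| ≤ (2 + 1) * M := d4.trans (by gcongr)
  rw [abs_le] at *
  constructor <;> linarith [d1'.1, d1'.2, d2.1, d2.2, d3'.1, d3'.2, d4'.1, d4'.2]

lemma exists_cut (hn : 1 ≤ n) : ∃ C : ℝ, 0 < C ∧ ∀ (U : Set (Hpt n)) (v : Hpt n → ℝ) (M : ℝ),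
    IsOpen U → IsC1H U v → Metric.closedBall 0 4 ⊆ U → v 0 = 0 →
    (∀ q ∈ Metric.closedBall (0 : Hpt n) 4, ∀ j, |gradH v q j| ≤ M) →
    ∃ w : Hpt n → ℝ, IsC1H univ w ∧ (∀ q j, |gradH w q j| ≤ C * M) ∧ w =ᶠ[𝓝 0] v := by
  let φ : ContDiffBump (0 : Hpt n) := ⟨1 / 2, 1, by norm_num, by norm_num⟩
  have hφs : ContDiff ℝ (⊤ : ℕ∞) φ := φ.contDiff
  have hφC : IsC1H univ φ := isC1H_smooth hφs
  obtain ⟨A, hA⟩ := (isCompact_closedBall (0 : Hpt n) 1).exists_bound_of_continuousOn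
      (continuous_pi fun j => continuousOn_univ.1 (hφC.contGrad j)).continuousOn
  refine ⟨|A| * (2 * n + 6) + 1, by positivity, fun U v M hU hv1 hBU h0 hM => ?_⟩
  have hM0 : 0 ≤ M := (abs_nonneg _).trans
    (hM 0 (Metric.mem_closedBall_self (by norm_num)) ⟨0, by omega⟩)
  have hsub : Metric.closedBall (0 : Hpt n) 1 ⊆ Metric.closedBall 0 4 :=
    Metric.closedBall_subset_closedBall (by norm_num)
  have hz : ∀ q, q ∉ Metric.closedBall (0 : Hpt n) 1 → φ q = 0 := fun q hq => by
    apply φ.zero_of_le_dist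
    exact (not_le.1 (mt Metric.mem_closedBall.2 hq)).le
  refine ⟨fun q => φ q * v q, isC1H_cutoff hU Metric.isClosed_closedBall (hsub.trans hBU) hφs hz hv1,
    fun q j => ?_, ?_⟩
  · by_cases hq : q ∈ Metric.closedBall (0 : Hpt n) 1
    · have h1 : |gradH φ q j| ≤ |A| :=
        ((norm_le_pi_norm (gradH φ q) j).trans (hA q hq)).trans (le_abs_self _)
      have h2 := box_estimate hn hU hv1 hBU h0 hM hq
      have h3 : |φ q| ≤ 1 := by
        rw [abs_of_nonneg φ.nonneg]
        exact φ.le_one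
      rw [gradH_mul (hφC.mono (subset_univ U)) hv1 (hBU (hsub hq))]
      calc _ ≤ |A| * ((2 * n + 6) * M) + 1 * M := by
            refine (abs_add_le _ _).trans ?_
            rw [abs_mul, abs_mul]
            exact add_le_add (mul_le_mul h1 h2 (abs_nonneg _) (abs_nonneg _))
              (mul_le_mul h3 (hM q (hsub hq) j) (abs_nonneg _) zero_le_one)
        _ = _ := by ring
    · have : (fun q => φ q * v q) =ᶠ[𝓝 q] fun _ => 0 := by
        filter_upwards [Metric.isClosed_closedBall.isOpen_compl.mem_nhds hq] with q' hq'
        rw [hz q' hq', zero_mul]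
      rw [gradH_congr this]
      have : gradH (fun _ : Hpt n => (0:ℝ)) q j = 0 := by
        simp [gradH, lineDeriv]
      rw [this, abs_zero]
      positivity
  · filter_upwards [φ.eventuallyEq_one] with q hq
    rw [hq]
    simp

lemma gradH_lin (A B : Fin n → ℝ) (q : Hpt n) (j : Fin (2*n)) :
    gradH (fun q : Hpt n => ∑ i, (q.1 i * A i + q.2.1 i * B i)) q j =
      ∑ i, (dA j i * A i + dB j i * B i) := by
  apply gradH_eq_of_hasLine
  rw [hasLine_iff]
  have : ∀ s : ℝ, ∑ i, ((q + s • hv q (dA j) (dB j)).1 i * A i +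
      (q + s • hv q (dA j) (dB j)).2.1 i * B i) = ∑ i, (q.1 i * A i + q.2.1 i * B i) +
      s * ∑ i, (dA j i * A i + dB j i * B i) := fun s => by
    rw [Finset.mul_sum, ← Finset.sum_add_distrib]
    refine Finset.sum_congr rfl fun i _ => ?_
    simp [hv]
    ring
  simp only [this]
  simpa using ((hasDerivAt_id (0:ℝ)).mul_const
    (∑ i, (dA j i * A i + dB j i * B i))).const_add (∑ i, (q.1 i * A i + q.2.1 i * B i))

/-- A `C¹_ℍ` function near `0` agrees near `0` with a global one whose gradient is
uniformly close to the gradient at `0`. -/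
lemma exists_global_close (hn : 1 ≤ n) {U : Set (Hpt n)} (hU : IsOpen U) {f : Hpt n → ℝ}
    (hf : IsC1H U f) (h0U : (0 : Hpt n) ∈ U) (hf0 : f 0 = 0) {ε : ℝ} (hε : 0 < ε) :
    ∃ F : Hpt n → ℝ, IsC1H univ F ∧ F =ᶠ[𝓝 0] f ∧
      ∀ q j, |gradH F q j - gradH f 0 j| ≤ ε := by
  obtain ⟨C, hC, hcut⟩ := exists_cut hn
  set L : Hpt n → ℝ := fun q => ∑ i : Fin n, (q.1 i * gradH f 0 ⟨(i:ℕ), by omega⟩ +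
    q.2.1 i * gradH f 0 ⟨n + (i:ℕ), by omega⟩) with hL
  have hLs : ContDiff ℝ (⊤ : ℕ∞) L := by
    rw [hL]
    refine ContDiff.sum fun i _ => ?_
    fun_prop
  have hLC : IsC1H univ L := isC1H_smooth hLs
  have hLg : ∀ q j, gradH L q j = gradH f 0 j := fun q j => by
    rw [hL, gradH_lin]
    exact pD_dir f 0 j
  set u : Hpt n → ℝ := fun q => f q + (-1) * L q with hu
  have huC : IsC1H U u := hf.add ((hLC.mono (subset_univ U)).cmul (-1))
  have hug : ∀ q ∈ U, ∀ j, gradH u q j = gradH f q j - gradH f 0 j := fun q hq j => by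
    rw [hu, gradH_add hf ((hLC.mono (subset_univ U)).cmul (-1)) hq,
      gradH_cmul (hLC.mono (subset_univ U)) (-1) hq, hLg]
    ring
  have hev : ∀ᶠ q in 𝓝 (0 : Hpt n), q ∈ U ∧ ∀ j, |gradH u q j| ≤ ε / C := by
    refine (hU.eventually_mem h0U).and (eventually_all.2 fun j => ?_)
    have hcont : ContinuousAt (fun q => |gradH u q j|) 0 :=
      ((huC.contGrad j).continuousAt (hU.mem_nhds h0U)).abs
    have : |gradH u 0 j| < ε / C := by
      rw [hug 0 h0U, sub_self, abs_zero]
      positivity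
    filter_upwards [hcont.eventually_lt continuousAt_const this] with q hq
    exact hq.le
  obtain ⟨ρ, hρ, hball⟩ := Metric.eventually_nhds_iff_ball.1 hev
  set r : ℝ := min 1 (ρ / 5) with hr
  have hr0 : 0 < r := lt_min one_pos (by positivity)
  have hr1 : r ≤ 1 := min_le_left _ _
  have hr2 : r * 4 < ρ := by
    have : r ≤ ρ / 5 := min_le_right _ _
    linarith
  have hdilmem : ∀ q ∈ Metric.closedBall (0 : Hpt n) 4, hdil r q ∈ Metric.ball (0 : Hpt n) ρ := by
    intro q hq
    refine Metric.closedBall_subset_ball hr2 ?_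
    obtain ⟨h1, h2, h3⟩ := (mem_cball (by norm_num)).1 hq
    rw [mem_cball (by positivity)]
    refine ⟨fun j => ?_, fun j => ?_, ?_⟩
    · simp only [hdil, Pi.smul_apply, smul_eq_mul, abs_mul, abs_of_pos hr0]
      gcongr
      exact h1 j
    · simp only [hdil, Pi.smul_apply, smul_eq_mul, abs_mul, abs_of_pos hr0]
      gcongr
      exact h2 j
    · simp only [hdil, abs_mul, abs_of_pos (pow_pos hr0 2)]
      have : r ^ 2 ≤ r := by nlinarith
      gcongr
  have hvC := (isC1H_dil r huC).cmul r⁻¹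
  have hvg : ∀ q, hdil r q ∈ U → ∀ j, gradH (fun q => r⁻¹ * u (hdil r q)) q j =
      gradH u (hdil r q) j := fun q hq j => by
    rw [gradH_cmul (isC1H_dil r huC) r⁻¹ hq, gradH_dil r huC hq]
    field_simp
  have hdil0 : ∀ s : ℝ, hdil s (0 : Hpt n) = 0 := fun s => by
    unfold hdil
    refine Prod.ext ?_ (Prod.ext ?_ ?_) <;> simp
  have hL0 : L 0 = 0 := by simp [hL]
  obtain ⟨w, hw1, hw2, hw3⟩ := hcut _ _ (ε / C) (hU.preimage (continuous_hdil r)) hvC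
    (fun q hq => (hball _ (hdilmem q hq)).1) (by
      simp [hdil0, hu, hf0, hL0])
    (fun q hq j => by
      rw [hvg q (hball _ (hdilmem q hq)).1]
      exact (hball _ (hdilmem q hq)).2 j)
  have hwC : IsC1H univ (fun q => w (hdil r⁻¹ q)) := isC1H_dil r⁻¹ hw1
  refine ⟨fun q => L q + r * w (hdil r⁻¹ q), hLC.add (hwC.cmul r), ?_, fun q j => ?_⟩
  · have ht : Tendsto (hdil (n := n) r⁻¹) (𝓝 0) (𝓝 0) := by
      have := (continuous_hdil (n := n) r⁻¹).tendsto 0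
      rwa [hdil0] at this
    filter_upwards [ht.eventually hw3] with q hq
    have : hdil r (hdil r⁻¹ q) = q := by
      unfold hdil
      refine Prod.ext ?_ (Prod.ext ?_ ?_)
      · simp [smul_smul, hr0.ne']
      · simp [smul_smul, hr0.ne']
      · simp only
        field_simp
    rw [hq, this]
    simp only [hu]
    field_simp
    ring
  · rw [gradH_add hLC (hwC.cmul r) (mem_univ q), gradH_cmul hwC r (mem_univ q),
      gradH_dil r⁻¹ hw1 (mem_univ _), hLg]
    have h := hw2 (hdil r⁻¹ q) j
    rw [mul_div_cancel₀ _ hC.ne'] at h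
    have e : gradH f 0 j + r * (r⁻¹ * gradH w (hdil r⁻¹ q) j) - gradH f 0 j =
      gradH w (hdil r⁻¹ q) j := by field_simp; ring
    rw [e]
    exact h


/-! ## Good global defining functions at the origin -/

lemma quad_lower {k : ℕ} (hk : 1 ≤ k) (g : Fin k → Fin k → ℝ)
    (hg : ∀ i j, |g i j - if i = j then 1 else 0| ≤ 1 / (2 * k)) (ξ : Fin k → ℝ) :
    1 / 2 * ∑ i, ξ i ^ 2 ≤ ∑ i, ∑ j, ξ i * g i j * ξ j := by
  have hk0 : (0:ℝ) < k := by exact_mod_cast hk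
  have h1 : ∀ i j, (if i = j then ξ i * ξ j else 0) - 1 / (2 * k) * ((ξ i ^ 2 + ξ j ^ 2) / 2) ≤
      ξ i * g i j * ξ j := fun i j => by
    have h2 : |ξ i * ξ j * (g i j - if i = j then 1 else 0)| ≤
        (ξ i ^ 2 + ξ j ^ 2) / 2 * (1 / (2 * k)) := by
      rw [abs_mul]
      refine mul_le_mul ?_ (hg i j) (abs_nonneg _) (by positivity)
      rw [abs_le]
      constructor <;> nlinarith [sq_nonneg (ξ i + ξ j), sq_nonneg (ξ i - ξ j)]
    have h3 := (abs_le.1 h2).1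
    have h4 : (if i = j then ξ i * ξ j else 0) = ξ i * ξ j * (if i = j then 1 else 0) := by
      split_ifs <;> simp
    rw [h4]
    linarith
  have h2 := Finset.sum_le_sum (s := Finset.univ) fun i _ =>
    Finset.sum_le_sum (s := Finset.univ) fun j _ => h1 i j
  refine le_trans (le_of_eq ?_) h2
  simp only [Finset.sum_sub_distrib, Finset.sum_ite_eq, Finset.mem_univ, if_true,
    ← Finset.mul_sum, ← Finset.sum_div, Finset.sum_add_distrib, Finset.sum_const, Finset.card_univ,
    Fintype.card_fin, nsmul_eq_mul]
  have h3 : ∑ i, ξ i * ξ i = ∑ i, ξ i ^ 2 := Finset.sum_congr rfl fun i _ => by ring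
  rw [h3]
  field_simp
  ring

lemma exists_good (hn : 1 ≤ n) {k : ℕ} (hk1 : 1 ≤ k) (hk2 : k ≤ n) {U : Set (Hpt n)}
    (hU : IsOpen U) (h0U : (0 : Hpt n) ∈ U) {f : Fin k → Hpt n → ℝ} (hf : ∀ i, IsC1H U (f i))
    (hf0 : ∀ i, f i 0 = 0)
    (hgr : ∀ i j : Fin k, gradNat (f j) 0 (i:ℕ) = if i = j then 1 else 0) :
    ∃ (V : Set (Hpt n)) (F : Fin k → Hpt n → ℝ), IsOpen V ∧ (0 : Hpt n) ∈ V ∧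
      (∀ i, IsC1H univ (F i)) ∧
      (∃ C : ℝ, ∀ (i : Fin k) (q : Hpt n) (j : Fin (2*n)), |gradH (F i) q j| ≤ C) ∧
      (∀ i, ContDiffOn ℝ (⊤ : ℕ∞) (F i) {q | ¬ ∀ i', F i' q = 0}) ∧
      (∀ (q : Hpt n) (ξ : Fin k → ℝ),
        1 / 2 * ∑ i, ξ i ^ 2 ≤ ∑ i, ∑ j, ξ i * gradNat (F j) q (i : ℕ) * ξ j) ∧
      ∀ q ∈ V, ((∀ i, F i q = 0) ↔ ∀ i, f i q = 0) := by
  have hk0 : (0:ℝ) < k := by exact_mod_cast hk1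
  set ε : ℝ := 1 / (4 * k) with hε
  have hε0 : 0 < ε := by positivity
  choose G hG1 hG2 hG3 using fun i => exists_global_close hn hU (hf i) h0U (hf0 i) hε0
  obtain ⟨h, hh1, hh2, hh3, hh4⟩ := smooth_off G hG1 hε0
  have hzero : ∀ q, (∀ i, G i q + h i q = 0) ↔ ∀ i, G i q = 0 := fun q => by
    constructor
    · intro hq
      have h1 : ‖fun i => G i q‖ ≤ ‖fun i => G i q‖ / 2 := by
        refine (pi_norm_le_iff_of_nonneg (by positivity)).2 fun i => ?_
        have h2 : G i q = - h i q := by linarith [hq i]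
        rw [h2, norm_neg]
        exact hh3 i q
      have h2 : ‖fun i => G i q‖ = 0 := le_antisymm (by linarith) (norm_nonneg _)
      exact fun i => congrFun (norm_eq_zero.1 h2) i
    · intro hq i
      have h1 := hh3 i q
      have h2 : (fun i => G i q) = 0 := funext hq
      rw [h2, norm_zero, zero_div] at h1
      rw [hq i, abs_nonpos_iff.1 h1, add_zero]
  have hgF : ∀ i q j, |gradH (fun q => G i q + h i q) q j - gradH (f i) 0 j| ≤ 2 * ε := by
    intro i q j
    rw [gradH_add (hG1 i) (hh1 i) (mem_univ q)]
    have h1 := abs_le.1 (hG3 i q j)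
    have h2 := abs_le.1 (hh2 i q j)
    rw [abs_le]
    constructor <;> linarith
  obtain ⟨V, hV, hVo, h0V⟩ := eventually_nhds_iff.1 (eventually_all.2 hG2)
  refine ⟨V, fun i q => G i q + h i q, hVo, h0V, fun i => (hG1 i).add (hh1 i), ?_, fun i => ?_,
    fun q ξ => ?_, fun q hq => ?_⟩
  · refine ⟨2 * ε + ∑ i, ∑ j, |gradH (f i) 0 j|, fun i q j => ?_⟩
    have h1 : |gradH (f i) 0 j| ≤ ∑ i, ∑ j, |gradH (f i) 0 j| :=
      (Finset.single_le_sum (f := fun j => |gradH (f i) 0 j|) (fun _ _ => abs_nonneg _)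
        (Finset.mem_univ j)).trans
      (Finset.single_le_sum (f := fun i => ∑ j, |gradH (f i) 0 j|)
        (fun _ _ => Finset.sum_nonneg fun _ _ => abs_nonneg _) (Finset.mem_univ i))
    have h2 := abs_sub_abs_le_abs_sub (gradH (fun q => G i q + h i q) q j) (gradH (f i) 0 j)
    linarith [hgF i q j]
  · simp only [hzero]
    exact hh4 i
  · refine quad_lower hk1 (fun i j => gradNat (fun q => G j q + h j q) q (i:ℕ)) (fun i j => ?_) ξ
    have hi : (i:ℕ) < 2 * n := by omega
    have h1 := hgF j q ⟨i, hi⟩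
    have h2 := hgr i j
    simp only [gradNat, hi, dite_true] at h2 ⊢
    rw [← h2]
    refine h1.trans (le_of_eq ?_)
    rw [hε]
    field_simp
    norm_num
  · rw [hzero]
    exact forall_congr' fun i => by rw [hV q hq i]


/-! ## Linear algebra: isotropic complements -/

section LinAlg

variable {E : Type*} [NormedAddCommGroup E] [InnerProductSpace ℂ E]

lemma exists_unit_vec (E' : Submodule ℂ E) (W : Submodule ℝ E)
    (hW : W ≤ E'.restrictScalars ℝ) (hne : ∃ a ∈ E', a ∉ W) :
    ∃ v ∈ E', ‖v‖ = 1 ∧ v ∉ W ∧ (W = ⊥ ∨ ∃ w ∈ W, (inner ℂ v w : ℂ).im ≠ 0) := by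
  suffices h : ∃ v ∈ E', v ∉ W ∧ (W = ⊥ ∨ ∃ w ∈ W, (inner ℂ v w : ℂ).im ≠ 0) by
    obtain ⟨v, hv1, hv2, hv3⟩ := h
    have hv0 : v ≠ 0 := fun h0 => hv2 (h0 ▸ W.zero_mem)
    have hn0 : ‖v‖ ≠ 0 := norm_ne_zero_iff.2 hv0
    refine ⟨(‖v‖⁻¹ : ℝ) • v, (E'.restrictScalars ℝ).smul_mem _ hv1, ?_, ?_, ?_⟩
    · rw [norm_smul, norm_inv, norm_norm, inv_mul_cancel₀ hn0]
    · intro h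
      apply hv2
      have := W.smul_mem ‖v‖ h
      rwa [smul_smul, mul_inv_cancel₀ hn0, one_smul] at this
    · rcases hv3 with h | ⟨w, hw, hw2⟩
      · exact Or.inl h
      · refine Or.inr ⟨w, hw, ?_⟩
        have : ((‖v‖⁻¹ : ℝ) • v) = ((‖v‖⁻¹ : ℝ) : ℂ) • v := (Complex.coe_smul _ _).symm
        rw [this, inner_smul_left, Complex.conj_ofReal, Complex.im_ofReal_mul]
        exact mul_ne_zero (inv_ne_zero hn0) hw2
  obtain ⟨a, ha1, ha2⟩ := hne
  by_cases hb : W = ⊥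
  · exact ⟨a, ha1, ha2, Or.inl hb⟩
  obtain ⟨w, hw, hw0⟩ := (Submodule.ne_bot_iff W).1 hb
  have him : (inner ℂ (Complex.I • w) w : ℂ).im ≠ 0 := by
    rw [inner_smul_left, inner_self_eq_norm_sq_to_K]
    have : ‖w‖ ≠ 0 := norm_ne_zero_iff.2 hw0
    simp [← Complex.ofReal_pow, this]
  have hIw : Complex.I • w ∈ E' := E'.smul_mem _ (hW hw)
  by_cases h1 : (inner ℂ a w : ℂ).im = 0
  · by_cases h2 : Complex.I • w ∈ W
    · refine ⟨a + Complex.I • w, E'.add_mem ha1 hIw, fun h => ha2 ?_, Or.inr ⟨w, hw, ?_⟩⟩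
      · simpa using W.sub_mem h h2
      · rw [inner_add_left, Complex.add_im, h1, zero_add]
        exact him
    · exact ⟨_, hIw, h2, Or.inr ⟨w, hw, him⟩⟩
  · exact ⟨a, ha1, ha2, Or.inr ⟨w, hw, h1⟩⟩

lemma iso_compl [FiniteDimensional ℂ E] : ∀ (k : ℕ) (E' : Submodule ℂ E) (W : Submodule ℝ E),
    W ≤ E'.restrictScalars ℝ → k ≤ Module.finrank ℂ E' →
    Module.finrank ℝ W + k ≤ 2 * Module.finrank ℂ E' →
    ∃ v : Fin k → E, Orthonormal ℂ v ∧ (∀ j, v j ∈ E') ∧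
      ∀ c : Fin k → ℝ, ∑ j, c j • v j ∈ W → c = 0 := by
  have : FiniteDimensional ℝ E := FiniteDimensional.complexToReal E
  intro k
  induction k with
  | zero =>
    intro E' W _ _ _
    exact ⟨Fin.elim0, ⟨fun j => j.elim0, fun j => j.elim0⟩, fun j => j.elim0,
      fun c _ => funext fun j => j.elim0⟩
  | succ k ih =>
    intro E' W hW hk hd
    have hfr : Module.finrank ℝ (E'.restrictScalars ℝ) = 2 * Module.finrank ℂ E' :=
      finrank_real_of_complex E'
    have hne : ∃ a ∈ E', a ∉ W := by
      by_contra hcon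
      push Not at hcon
      have : Module.finrank ℝ (E'.restrictScalars ℝ) ≤ Module.finrank ℝ W :=
        Submodule.finrank_mono hcon
      omega
    obtain ⟨v, hvE, hv1, hvW, hvw⟩ := exists_unit_vec E' W hW hne
    have hv0 : v ≠ 0 := fun h => by simp [h] at hv1
    have hvv : (inner ℂ v v : ℂ) = 1 := by
      rw [inner_self_eq_norm_sq_to_K, hv1]
      simp
    set E2 : Submodule ℂ E := (ℂ ∙ v)ᗮ ⊓ E' with hE2
    have hE2d : 1 + Module.finrank ℂ E2 = Module.finrank ℂ E' := by
      have := Submodule.finrank_add_inf_finrank_orthogonal (𝕜 := ℂ) (K₁ := ℂ ∙ v) (K₂ := E')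
        ((Submodule.span_singleton_le_iff_mem v E').2 hvE)
      rwa [finrank_span_singleton hv0] at this
    set Z : Submodule ℝ E := W ⊔ (ℝ ∙ v) with hZ
    have hvZ : v ∈ Z := Submodule.mem_sup_right (Submodule.mem_span_singleton_self v)
    have hWZ : W ≤ Z := le_sup_left
    have hZE : Z ≤ E'.restrictScalars ℝ :=
      sup_le hW ((Submodule.span_singleton_le_iff_mem v _).2 hvE)
    have hZd : Module.finrank ℝ Z ≤ Module.finrank ℝ W + 1 := by
      have h1 := Submodule.finrank_add_le_finrank_add_finrank W (ℝ ∙ v)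
      rw [finrank_span_singleton hv0] at h1
      exact h1
    let Φ : E →ₗ[ℝ] ℂ := ((innerSL ℂ v : E →L[ℂ] ℂ) : E →ₗ[ℂ] ℂ).restrictScalars ℝ
    have hΦ : ∀ z, Φ z = inner ℂ v z := fun z => rfl
    have hrn := LinearMap.finrank_range_add_finrank_ker (Φ.domRestrict Z)
    set W2 : Submodule ℝ E := (LinearMap.ker (Φ.domRestrict Z)).map Z.subtype with hW2
    have hW2d : Module.finrank ℝ W2 = Module.finrank ℝ (LinearMap.ker (Φ.domRestrict Z)) :=
      Submodule.finrank_map_subtype_eq _ _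
    have hmem : ∀ z, z ∈ Z → (inner ℂ v z : ℂ) = 0 → z ∈ W2 := fun z h1 h2 =>
      ⟨⟨z, h1⟩, h2, rfl⟩
    have hmem2 : ∀ z ∈ W2, z ∈ Z ∧ (inner ℂ v z : ℂ) = 0 := by
      rintro _ ⟨z, hz, rfl⟩
      exact ⟨z.2, hz⟩
    have hW2E : W2 ≤ E2.restrictScalars ℝ := fun z hz => by
      obtain ⟨h1, h2⟩ := hmem2 z hz
      exact ⟨Submodule.mem_orthogonal_singleton_iff_inner_right.2 h2, hZE h1⟩
    have hrange : Module.finrank ℝ W2 + k ≤ 2 * Module.finrank ℂ E2 := by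
      rcases hvw with hb | ⟨w, hw, him⟩
      · have h1 : 0 < Module.finrank ℝ (LinearMap.range (Φ.domRestrict Z)) := by
          rw [Module.finrank_pos_iff_exists_ne_zero]
          refine ⟨⟨Φ v, ⟨⟨v, hvZ⟩, rfl⟩⟩, fun h => ?_⟩
          have : Φ v = 0 := congrArg Subtype.val h
          rw [hΦ, hvv] at this
          exact one_ne_zero this
        have h2 : Module.finrank ℝ W = 0 := by rw [hb, finrank_bot]
        omega
      · have h1 : LinearMap.range (Φ.domRestrict Z) = ⊤ := by
          rw [LinearMap.range_eq_top]
          intro z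
          set c : ℂ := inner ℂ v w with hc
          refine ⟨⟨(z.re - z.im / c.im * c.re) • v + (z.im / c.im) • w,
            Z.add_mem (Z.smul_mem _ hvZ) (Z.smul_mem _ (hWZ hw))⟩, ?_⟩
          change Φ ((z.re - z.im / c.im * c.re) • v + (z.im / c.im) • w) = z
          rw [map_add, map_smul, map_smul, hΦ, hΦ, hvv, ← hc]
          apply Complex.ext
          · simp
          · simp [him]
        rw [h1, finrank_top, Complex.finrank_real_complex] at hrn
        omega
    obtain ⟨u, hu1, hu2, hu3⟩ := ih E2 W2 hW2E (by omega) hrange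
    have hperp : ∀ j, (inner ℂ v (u j) : ℂ) = 0 := fun j =>
      Submodule.mem_orthogonal_singleton_iff_inner_right.1 (hu2 j).1
    refine ⟨Fin.cons v u, ?_, ?_, ?_⟩
    · rw [orthonormal_iff_ite] at hu1 ⊢
      intro i j
      refine Fin.cases ?_ (fun i => ?_) i <;> refine Fin.cases ?_ (fun j => ?_) j
      · simpa using hvv
      · simpa [(Fin.succ_ne_zero j).symm] using hperp j
      · have h := hperp i
        rw [← inner_conj_symm, map_eq_zero] at h
        simpa [Fin.succ_ne_zero i] using h
      · simpa using hu1 i j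
    · intro j
      refine Fin.cases hvE (fun j => (hu2 j).2) j
    · intro c hc
      rw [Fin.sum_univ_succ] at hc
      simp only [Fin.cons_zero, Fin.cons_succ] at hc
      have h1 : ∑ j : Fin k, c j.succ • u j ∈ W2 := by
        refine hmem _ ?_ ?_
        · have := Z.sub_mem (hWZ hc) (Z.smul_mem (c 0) hvZ)
          rwa [add_sub_cancel_left] at this
        · rw [← hΦ, map_sum]
          exact Finset.sum_eq_zero fun j _ => by rw [map_smul, hΦ, hperp, smul_zero]
      have h2 := hu3 _ h1
      have h3 : ∀ j : Fin k, c j.succ = 0 := fun j => congrFun h2 j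
      simp only [h3, zero_smul, Finset.sum_const_zero, add_zero] at hc
      have h4 : c 0 = 0 := by
        by_contra h
        apply hvW
        have := W.smul_mem (c 0)⁻¹ hc
        rwa [smul_smul, inv_mul_cancel₀ h, one_smul] at this
      ext j
      exact Fin.cases h4 h3 j

end LinAlg


/-! ## Rotations from unitary maps -/

/-- The horizontal part of a point as a complex vector. -/
def zc (p : Hpt n) : EuclideanSpace ℂ (Fin n) :=
  WithLp.toLp 2 fun j => (⟨p.1 j, p.2.1 j⟩ : ℂ)

/-- The rotation of the horizontal layer induced by a unitary map. -/
def rotT (T : EuclideanSpace ℂ (Fin n) ≃ₗᵢ[ℂ] EuclideanSpace ℂ (Fin n)) (p : Hpt n) : Hpt n :=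
  (fun j => (T (zc p) j).re, fun j => (T (zc p) j).im, p.2.2)

lemma zc_rotT (T : EuclideanSpace ℂ (Fin n) ≃ₗᵢ[ℂ] EuclideanSpace ℂ (Fin n)) (p : Hpt n) :
    zc (rotT T p) = T (zc p) := by
  ext j
  simp [zc, rotT]

lemma rotT_symm (T : EuclideanSpace ℂ (Fin n) ≃ₗᵢ[ℂ] EuclideanSpace ℂ (Fin n)) (p : Hpt n) :
    rotT T.symm (rotT T p) = p := by
  unfold rotT
  have h := zc_rotT T p
  unfold rotT at h
  rw [h]
  simp [zc]

lemma hmul_zc (p q : Hpt n) : (hmul p q).2.2 =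
    p.2.2 + q.2.2 + (inner ℂ (zc p) (zc q) : ℂ).im / 2 := by
  have : (inner ℂ (zc p) (zc q) : ℂ).im = ∑ j, p.1 j * q.2.1 j - ∑ j, q.1 j * p.2.1 j := by
    rw [PiLp.inner_apply, Complex.im_sum, ← Finset.sum_sub_distrib]
    refine Finset.sum_congr rfl fun j _ => ?_
    simp [zc]
    ring
  rw [this]
  unfold hmul
  ring

lemma zc_add (p q : Hpt n) : zc (p + q) = zc p + zc q := by
  ext j
  apply Complex.ext <;> simp [zc]

lemma zc_smul (c : ℝ) (p : Hpt n) : zc (c • p) = (c : ℂ) • zc p := by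
  ext j
  apply Complex.ext <;> simp [zc]

lemma zc_hmul (p q : Hpt n) : zc (hmul p q) = zc p + zc q := by
  ext j
  apply Complex.ext <;> simp [zc, hmul]

lemma zc_hdil (c : ℝ) (p : Hpt n) : zc (hdil c p) = (c : ℂ) • zc p := by
  ext j
  apply Complex.ext <;> simp [zc, hdil]

lemma isRotation_rotT (T : EuclideanSpace ℂ (Fin n) ≃ₗᵢ[ℂ] EuclideanSpace ℂ (Fin n)) :
    IsRotation (rotT T) := by
  refine ⟨⟨fun p q => ?_, fun c p => ?_⟩, fun p q => ?_, fun l p => ?_, fun p => rfl, fun p => ?_⟩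
  · unfold rotT
    rw [zc_add, map_add]
    refine Prod.ext ?_ (Prod.ext ?_ rfl) <;> ext j <;> simp
  · unfold rotT
    rw [zc_smul, map_smul]
    refine Prod.ext ?_ (Prod.ext ?_ rfl) <;> ext j <;> simp
  · refine Prod.ext ?_ (Prod.ext ?_ ?_)
    · ext j
      change (T (zc (hmul p q)) j).re = (T (zc p) j).re + (T (zc q) j).re
      simp [zc_hmul]
    · ext j
      change (T (zc (hmul p q)) j).im = (T (zc p) j).im + (T (zc q) j).im
      simp [zc_hmul]
    · rw [hmul_zc, zc_rotT, zc_rotT, T.inner_map_map]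
      exact hmul_zc p q
  · unfold rotT
    rw [zc_hdil, map_smul]
    refine Prod.ext ?_ (Prod.ext ?_ rfl) <;> ext j <;> simp [hdil]
  · have key : ∀ p : Hpt n, ∑ j, (p.1 j ^ 2 + p.2.1 j ^ 2) = ‖zc p‖ ^ 2 := fun p => by
      rw [EuclideanSpace.norm_sq_eq]
      refine Finset.sum_congr rfl fun j _ => ?_
      rw [← Complex.normSq_eq_norm_sq, Complex.normSq_apply]
      simp [zc]
      ring
    rw [key, key, zc_rotT, T.norm_map]

lemma exists_rot {k : ℕ} (hk : k ≤ n) (G : Fin k → Fin (2*n) → ℝ) (hG : LinearIndependent ℝ G) :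
    ∃ Q R : Hpt n → Hpt n, IsRotation Q ∧ IsRotation R ∧ (∀ p, Q (R p) = p) ∧ (∀ p, R (Q p) = p) ∧
      ∀ c : Fin k → ℝ, (∀ i, ∑ l : Fin k, c l *
        (∑ j : Fin n, ((Q (Pi.single (Fin.castLE hk l) 1, 0, 0)).1 j * G i ⟨(j:ℕ), by omega⟩ +
          (Q (Pi.single (Fin.castLE hk l) 1, 0, 0)).2.1 j * G i ⟨n + (j:ℕ), by omega⟩)) = 0) →
        c = 0 := by
  let F : EuclideanSpace ℂ (Fin n) →ₗ[ℝ] (Fin k → ℝ) :=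
    { toFun := fun z i => ∑ j : Fin n, ((z j).re * G i ⟨(j:ℕ), by omega⟩ +
          (z j).im * G i ⟨n + (j:ℕ), by omega⟩)
      map_add' := fun z w => by
        ext i
        simp only [Pi.add_apply, ← Finset.sum_add_distrib]
        refine Finset.sum_congr rfl fun j _ => ?_
        simp
        ring
      map_smul' := fun a z => by
        ext i
        simp only [Pi.smul_apply, smul_eq_mul, Finset.mul_sum, RingHom.id_apply]
        refine Finset.sum_congr rfl fun j _ => ?_
        simp
        ring }
  have hF : ∀ z i, F z i = ∑ j : Fin n, ((z j).re * G i ⟨(j:ℕ), by omega⟩ +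
          (z j).im * G i ⟨n + (j:ℕ), by omega⟩) := fun _ _ => rfl
  have hsurj : LinearMap.range F = ⊤ := by
    by_contra hcon
    obtain ⟨g, hg0, hg⟩ := Submodule.exists_le_ker_of_lt_top _ (lt_top_iff_ne_top.2 hcon)
    apply hg0
    have hgz : ∀ z, ∑ i, F z i * g (Pi.single i 1) = 0 := fun z => by
      have h1 : g (F z) = 0 := hg ⟨z, rfl⟩
      rw [← Finset.univ_sum_single (F z), map_sum] at h1
      rw [← h1]
      refine Finset.sum_congr rfl fun i _ => ?_
      have : (Pi.single i (F z i) : Fin k → ℝ) = F z i • Pi.single i 1 := by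
        rw [← Pi.single_smul, smul_eq_mul, mul_one]
      simp [this]
    have hcoef : ∑ i, g (Pi.single i 1) • G i = 0 := by
      ext j
      rw [Finset.sum_apply, Pi.zero_apply]
      by_cases hj : (j:ℕ) < n
      · rw [← hgz (EuclideanSpace.single ⟨j, hj⟩ 1)]
        refine Finset.sum_congr rfl fun i _ => ?_
        rw [hF, Finset.sum_eq_single ⟨j, hj⟩]
        · simp [mul_comm]
        · intro l _ hl
          simp [hl]
        · simp
      · rw [← hgz (EuclideanSpace.single ⟨(j:ℕ) - n, by omega⟩ Complex.I)]
        refine Finset.sum_congr rfl fun i _ => ?_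
        rw [hF, Finset.sum_eq_single ⟨(j:ℕ) - n, by omega⟩]
        · have : (⟨n + ((j:ℕ) - n), by omega⟩ : Fin (2*n)) = j := Fin.ext (by simp; omega)
          simp [mul_comm, this]
        · intro l _ hl
          simp [hl]
        · simp
    have hz := Fintype.linearIndependent_iff.1 hG _ hcoef
    apply LinearMap.pi_ext'
    intro i
    ext
    simpa using hz i
  have hdim := LinearMap.finrank_range_add_finrank_ker F
  rw [hsurj, finrank_top, Module.finrank_fin_fun, finrank_real_of_complex,
    finrank_euclideanSpace_fin] at hdim
  obtain ⟨v, hv1, -, hv3⟩ := iso_compl k (⊤ : Submodule ℂ (EuclideanSpace ℂ (Fin n)))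
    (LinearMap.ker F) (fun _ _ => trivial) (by rw [finrank_top, finrank_euclideanSpace_fin]; exact hk)
    (by rw [finrank_top, finrank_euclideanSpace_fin]; omega)
  let v' : Fin n → EuclideanSpace ℂ (Fin n) := fun j => if h : (j:ℕ) < k then v ⟨j, h⟩ else 0
  have hv' : Orthonormal ℂ (Set.domRestrict {j : Fin n | (j:ℕ) < k} v') := by
    have e : Set.domRestrict {j : Fin n | (j:ℕ) < k} v' =
        v ∘ fun j : {j : Fin n | (j:ℕ) < k} => (⟨(j:Fin n), j.2⟩ : Fin k) := by
      ext1 j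
      have : ((j : Fin n) : ℕ) < k := j.2
      simp [v', Set.domRestrict, this]
    rw [e]
    refine hv1.comp _ fun i j h => ?_
    have := congrArg Fin.val h
    exact Subtype.ext (Fin.ext this)
  obtain ⟨b, hb⟩ := hv'.exists_orthonormalBasis_extension_of_card_eq (by simp)
  have hbT : ∀ l : Fin k, b (Fin.castLE hk l) = v l := fun l => by
    rw [hb _ (by simp)]
    simp [v']
  refine ⟨rotT b.repr.symm, rotT b.repr, isRotation_rotT _, isRotation_rotT _,
    fun p => rotT_symm b.repr p, fun p => rotT_symm b.repr.symm p, fun c hc => hv3 c ?_⟩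
  rw [LinearMap.mem_ker, map_sum]
  ext i
  rw [Finset.sum_apply, Pi.zero_apply, ← hc i]
  refine Finset.sum_congr rfl fun l _ => ?_
  rw [map_smul, Pi.smul_apply, smul_eq_mul, hF]
  have e : zc ((Pi.single (Fin.castLE hk l) 1, 0, 0) : Hpt n) =
      EuclideanSpace.single (Fin.castLE hk l) 1 := by
    ext j
    by_cases hj : j = Fin.castLE hk l
    · subst hj
      apply Complex.ext <;> simp [zc]
    · apply Complex.ext <;> simp [zc, hj]
  simp only [rotT, e, b.repr_symm_single, hbT]


/-! ## Proof of the main theorem -/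

lemma hmul_zero' (p : Hpt n) : hmul p 0 = p := by
  unfold hmul
  refine Prod.ext ?_ (Prod.ext ?_ ?_) <;> simp

lemma hmul_hinv_self (p : Hpt n) : hmul (hinv p) p = 0 := by
  unfold hmul hinv
  refine Prod.ext ?_ (Prod.ext ?_ ?_) <;> simp

lemma hmul_hinv_self' (p : Hpt n) : hmul p (hinv p) = 0 := by
  unfold hmul hinv
  refine Prod.ext ?_ (Prod.ext ?_ ?_) <;> simp

lemma sum_pD {k : ℕ} {f : Fin k → Hpt n → ℝ} {p : Hpt n} {c : Fin k → ℝ}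
    (h : ∀ j, ∑ i, c i * gradH (f i) p j = 0) (a b : Fin n → ℝ) :
    ∑ i, c i * pD (f i) p a b = 0 := by
  unfold pD
  simp only [Finset.mul_sum]
  rw [Finset.sum_comm]
  refine Finset.sum_eq_zero fun j _ => ?_
  have h1 := h ⟨(j:ℕ), by omega⟩
  have h2 := h ⟨n + (j:ℕ), by omega⟩
  calc _ = a j * ∑ i, c i * gradH (f i) p ⟨(j:ℕ), by omega⟩ +
        b j * ∑ i, c i * gradH (f i) p ⟨n + (j:ℕ), by omega⟩ := by
        rw [Finset.mul_sum, Finset.mul_sum, ← Finset.sum_add_distrib]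
        exact Finset.sum_congr rfl fun i _ => by ring
    _ = 0 := by rw [h1, h2, mul_zero, mul_zero, add_zero]

lemma isRot_surj {R : Hpt n → Hpt n} (hR : IsRotation R) (a b : Fin n → ℝ) :
    ∃ a' b' : Fin n → ℝ, R (a', b', 0) = (a, b, 0) := by
  have h : Function.Surjective (IsLinearMap.mk' R hR.1) :=
    LinearMap.injective_iff_surjective.1 (isRot_injective hR)
  obtain ⟨⟨a', b', t⟩, hw⟩ := h (a, b, 0)
  have hw' : R (a', b', t) = (a, b, 0) := hw
  have ht := hR.2.2.2.1 (a', b', t)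
  rw [hw'] at ht
  simp only at ht
  exact ⟨a', b', by rw [ht]; rw [← ht] at hw' ⊢; exact hw'⟩

lemma main_backward {k : ℕ} (hk2 : k ≤ n) {S : Set (Hpt n)} {p : Hpt n}
    {φ : Hpt n → Hpt n} (hφ : IsHIsom φ) {U : Set (Hpt n)} {f : Fin k → Hpt n → ℝ} {δ : ℝ}
    (hU : IsOpen U) (hpU : φ p ∈ U) (hδ : 0 < δ) (hf : ∀ i, IsC1H univ (f i))
    (hq : ∀ (q : Hpt n) (ξ : Fin k → ℝ),
      δ * ∑ i, ξ i ^ 2 ≤ ∑ i, ∑ j, ξ i * gradNat (f j) q (i : ℕ) * ξ j)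
    (hS : (φ '' S) ∩ U = {q ∈ U | ∀ i, f i q = 0}) :
    ∃ U : Set (Hpt n), IsOpen U ∧ p ∈ U ∧ ∃ f : Fin k → Hpt n → ℝ, (∀ i, IsC1H U (f i)) ∧
      (∀ q ∈ U, LinearIndependent ℝ (fun i => gradH (f i) q)) ∧
      S ∩ U = {q ∈ U | ∀ i, f i q = 0} := by
  obtain ⟨g, R, hR, rfl⟩ := hφ
  have hc : Continuous fun q => hmul g (R q) :=
    continuous_hmul.comp (continuous_const.prodMk (isRot_continuous hR))
  refine ⟨_, hU.preimage hc, hpU, fun i q => f i (hmul g (R q)),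
    fun i => (isC1H_isom hR isOpen_univ (hf i)).mono (subset_univ _), fun q _ => ?_, ?_⟩
  · rw [Fintype.linearIndependent_iff]
    intro c hcz
    have h1 : ∀ j, ∑ i, c i * gradH (fun q => f i (hmul g (R q))) q j = 0 := fun j => by
      have := congrFun hcz j
      simpa [Finset.sum_apply] using this
    have h2 : ∀ j, ∑ i, c i * gradH (f i) (hmul g (R q)) j = 0 := fun j => by
      obtain ⟨a, b, hab⟩ := isRot_surj hR (dA j) (dB j)
      have h3 := sum_pD h1 a b
      simp only [pD_isom hR isOpen_univ (hf _) (mem_univ _), hab, pD_dir] at h3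
      exact h3
    have h4 := hq (hmul g (R q)) c
    have h5 : ∑ i, ∑ j, c i * gradNat (f j) (hmul g (R q)) (i:ℕ) * c j = 0 := by
      refine Finset.sum_eq_zero fun i _ => ?_
      have hi : (i:ℕ) < 2 * n := by omega
      have h6 := h2 ⟨i, hi⟩
      calc _ = c i * ∑ j, c j * gradH (f j) (hmul g (R q)) ⟨i, hi⟩ := by
            rw [Finset.mul_sum]
            refine Finset.sum_congr rfl fun j _ => ?_
            simp only [gradNat, hi, dite_true]
            ring
        _ = 0 := by rw [h6, mul_zero]
    rw [h5] at h4
    have h7 : ∑ i, c i ^ 2 ≤ 0 := by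
      by_contra hcon
      push Not at hcon
      have := mul_pos hδ hcon
      linarith
    have h8 := (Finset.sum_eq_zero_iff_of_nonneg (fun i _ => sq_nonneg (c i))).1
      (le_antisymm h7 (Finset.sum_nonneg fun i _ => sq_nonneg (c i)))
    intro i
    simpa using h8 i (Finset.mem_univ i)
  · have hinj : Function.Injective fun q => hmul g (R q) :=
      (hmul_left_injective g).comp (isRot_injective hR)
    ext q
    have h1 := Set.ext_iff.1 hS (hmul g (R q))
    constructor
    · rintro ⟨hqS, hqU⟩
      exact h1.1 ⟨⟨q, hqS, rfl⟩, hqU⟩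
    · rintro hq2
      obtain ⟨⟨q', hq', he⟩, hqU⟩ := h1.2 hq2
      exact ⟨hinj he ▸ hq', hqU⟩

lemma main_forward (hn : 1 ≤ n) {k : ℕ} (hk1 : 1 ≤ k) (hk2 : k ≤ n) {S : Set (Hpt n)} {p : Hpt n}
    (hp : p ∈ S) {U : Set (Hpt n)} (hU : IsOpen U) (hpU : p ∈ U) {f : Fin k → Hpt n → ℝ}
    (hf : ∀ i, IsC1H U (f i)) (hind : LinearIndependent ℝ (fun i => gradH (f i) p))
    (hS : S ∩ U = {q ∈ U | ∀ i, f i q = 0}) :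
    ∃ φ : Hpt n → Hpt n, IsHIsom φ ∧
        ∃ (U : Set (Hpt n)) (f : Fin k → Hpt n → ℝ) (δ₀ : ℝ),
          IsOpen U ∧ φ p ∈ U ∧ 0 < δ₀ ∧
          (∀ i, IsC1H Set.univ (f i)) ∧
          (∃ C : ℝ, ∀ (i : Fin k) (q : Hpt n) (j : Fin (2*n)), |gradH (f i) q j| ≤ C) ∧
          (∀ i, ContDiffOn ℝ (⊤ : ℕ∞) (f i) {q | ¬ ∀ i', f i' q = 0}) ∧
          (∀ (q : Hpt n) (ξ : Fin k → ℝ),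
            δ₀ * ∑ i, ξ i ^ 2 ≤ ∑ i, ∑ j, ξ i * gradNat (f j) q (i : ℕ) * ξ j) ∧
          (φ '' S) ∩ U = {q ∈ U | ∀ i, f i q = 0} := by
  obtain ⟨Q, R, hQ, hR, hQR, hRQ, hinj⟩ := exists_rot hk2 _ hind
  have hQ0 : Q 0 = 0 := hQ.1.map_zero
  have hψ0 : hmul p (Q 0) = p := by rw [hQ0, hmul_zero']
  have hc : Continuous fun q => hmul p (Q q) :=
    continuous_hmul.comp (continuous_const.prodMk (isRot_continuous hQ))
  let φ : Hpt n → Hpt n := fun q => hmul (R (hinv p)) (R q)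
  have hφ : ∀ q, φ q = R (hmul (hinv p) q) := fun q => (hR.2.1 _ _).symm
  have hψφ : ∀ q, hmul p (Q (φ q)) = q := fun q => by
    rw [hφ, hQR, ← hmul_assoc', hmul_hinv_self', zero_hmul]
  have hφψ : ∀ q, φ (hmul p (Q q)) = q := fun q => by
    rw [hφ, ← hmul_assoc', hmul_hinv_self, zero_hmul, hRQ]
  have hφp : φ p = 0 := by
    rw [hφ, hmul_hinv_self]
    exact hR.1.map_zero
  let e : Fin k → Hpt n := fun l => Q (Pi.single (Fin.castLE hk2 l) 1, 0, 0)
  let M : Matrix (Fin k) (Fin k) ℝ := fun i l => pD (f i) p (e l).1 (e l).2.1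
  have hM : IsUnit M := by
    rw [← Matrix.mulVec_injective_iff_isUnit]
    rw [← Matrix.coe_mulVecLin, injective_iff_map_eq_zero]
    intro c hcz
    refine hinj c fun i => ?_
    have h1 := congrFun hcz i
    rw [Matrix.coe_mulVecLin] at h1
    refine Eq.trans ?_ h1
    simp only [Matrix.mulVec, dotProduct]
    refine Finset.sum_congr rfl fun l _ => ?_
    rw [mul_comm]
    rfl
  have hdet : IsUnit M.det := (Matrix.isUnit_iff_isUnit_det M).1 hM
  have hAM : M⁻¹ * M = 1 := Matrix.nonsing_inv_mul M hdet
  have hMA : M * M⁻¹ = 1 := Matrix.mul_nonsing_inv M hdet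
  set U0 : Set (Hpt n) := (fun q => hmul p (Q q)) ⁻¹' U with hU0
  have hU0o : IsOpen U0 := hU.preimage hc
  have h0U0 : (0 : Hpt n) ∈ U0 := by
    change hmul p (Q 0) ∈ U
    rwa [hψ0]
  have hfC : ∀ i, IsC1H U0 (fun q => f i (hmul p (Q q))) := fun i => isC1H_isom hQ hU (hf i)
  let F : Fin k → Hpt n → ℝ := fun j q => ∑ i, M⁻¹ j i * f i (hmul p (Q q))
  have hFC := fun j => isC1H_sum Finset.univ (fun i _ => (hfC i).cmul (M⁻¹ j i))
  have hfp : ∀ i, f i p = 0 := by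
    have : p ∈ {q ∈ U | ∀ i, f i q = 0} := hS ▸ ⟨hp, hpU⟩
    exact this.2
  have hFz : ∀ q, (∀ j, F j q = 0) ↔ ∀ i, f i (hmul p (Q q)) = 0 := fun q => by
    constructor
    · intro h
      have h1 : M⁻¹.mulVec (fun i => f i (hmul p (Q q))) = 0 := funext h
      have h2 := congrArg M.mulVec h1
      rw [Matrix.mulVec_mulVec, hMA, Matrix.one_mulVec, Matrix.mulVec_zero] at h2
      exact fun i => congrFun h2 i
    · intro h j
      simp only [F, h, mul_zero, Finset.sum_const_zero]
  obtain ⟨V, F', hV, h0V, hF1, hF2, hF3, hF4, hF5⟩ := exists_good hn hk1 hk2 hU0o h0U0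
    (f := F) (fun j => (hFC j).1) ((hFz 0).2 fun i => by rw [hψ0, hfp]) (fun l j => by
      have hl : (l:ℕ) < 2 * n := by omega
      simp only [gradNat, hl, dite_true]
      have h1 : gradH (F j) 0 ⟨l, hl⟩ = _ := (hFC j).2 0 h0U0 ⟨l, hl⟩
      rw [h1]
      have h2 : ∀ i, gradH (fun q => M⁻¹ j i * f i (hmul p (Q q))) 0 ⟨l, hl⟩ = M⁻¹ j i * M i l := by
        intro i
        rw [gradH_cmul (hfC i) _ h0U0, ← pD_dir, pD_isom hQ hU (hf i) (q := 0) h0U0, hψ0]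
        have h3 : dA (⟨(l:ℕ), hl⟩ : Fin (2*n)) = Pi.single (Fin.castLE hk2 l) 1 :=
          dA_X (Fin.castLE hk2 l)
        have h4 : dB (⟨(l:ℕ), hl⟩ : Fin (2*n)) = 0 := dB_X (Fin.castLE hk2 l)
        rw [h3, h4]
      simp only [h2]
      have h5 := congrFun (congrFun hAM j) l
      rw [Matrix.mul_apply, Matrix.one_apply] at h5
      rw [h5]
      simp only [eq_comm])
  refine ⟨φ, ⟨_, R, hR, rfl⟩, V ∩ U0, F', 1 / 2, hV.inter hU0o, ?_, by norm_num, hF1, hF2, hF3,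
    hF4, ?_⟩
  · rw [hφp]
    exact ⟨h0V, h0U0⟩
  · ext q
    constructor
    · rintro ⟨⟨q', hq', rfl⟩, hqV, hqU⟩
      refine ⟨⟨hqV, hqU⟩, (hF5 _ hqV).2 ((hFz _).2 ?_)⟩
      have hqU' : hmul p (Q (φ q')) ∈ U := hqU
      rw [hψφ] at hqU' ⊢
      have : q' ∈ {q ∈ U | ∀ i, f i q = 0} := hS ▸ ⟨hq', hqU'⟩
      exact this.2
    · rintro ⟨⟨hqV, hqU⟩, hz⟩
      have h1 := (hFz q).1 ((hF5 q hqV).1 hz)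
      have h2 : hmul p (Q q) ∈ S ∩ U := by
        rw [hS]
        exact ⟨hqU, h1⟩
      exact ⟨⟨_, h2.1, hφψ q⟩, hqV, hqU⟩


/-- **Global defining functions with good properties** (Lemma 2.9): for `1 ≤ k ≤ n`,
`S ⊂ ℍⁿ` is a `k`-codimensional `C¹_ℍ`-regular submanifold if and only if every `p ∈ S` admits
(up to an isometry of `ℍⁿ`) an open neighbourhood `U`, a globally defined `f : ℍⁿ → ℝ^k` and
`δ₀ > 0` such that: (1) `f ∈ C¹_ℍ(ℍⁿ,ℝ^k)`; (2) `|∇_ℍ f|` is bounded; (3) `f` is smooth off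
`{f = 0}`; (4) `∇̂_ℍ f ≥ δ₀ Id_{k×k}` in the sense of quadratic forms; (5)
`S ∩ U = {q ∈ U : f(q) = 0}`. -/
theorem global_defining_functions {n : ℕ} (hn : 1 ≤ n)
    (k : ℕ) (hk1 : 1 ≤ k) (hk2 : k ≤ n) (S : Set (Hpt n)) :
    IsC1HCodim k S ↔
      ∀ p ∈ S, ∃ φ : Hpt n → Hpt n, IsHIsom φ ∧
        ∃ (U : Set (Hpt n)) (f : Fin k → Hpt n → ℝ) (δ₀ : ℝ),
          IsOpen U ∧ φ p ∈ U ∧ 0 < δ₀ ∧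
          (∀ i, IsC1H Set.univ (f i)) ∧
          (∃ C : ℝ, ∀ (i : Fin k) (q : Hpt n) (j : Fin (2*n)), |gradH (f i) q j| ≤ C) ∧
          (∀ i, ContDiffOn ℝ (⊤ : ℕ∞) (f i) {q | ¬ ∀ i', f i' q = 0}) ∧
          (∀ (q : Hpt n) (ξ : Fin k → ℝ),
            δ₀ * ∑ i, ξ i ^ 2 ≤ ∑ i, ∑ j, ξ i * gradNat (f j) q (i : ℕ) * ξ j) ∧
          (φ '' S) ∩ U = {q ∈ U | ∀ i, f i q = 0} := by
  constructor
  · intro h p hp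
    obtain ⟨U, hU, hpU, f, hf, hind, hS⟩ := h p hp
    exact main_forward hn hk1 hk2 hp hU hpU hf (hind p hpU) hS
  · intro h p hp
    obtain ⟨φ, hφ, U, f, δ, hU, hpU, hδ, hf, -, -, hq, hS⟩ := h p hp
    exact main_backward hk2 hφ hU hpU hδ hf hq hS

end Heis
end
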